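/- One-step bound for the λ-LWW two-point function: let λ = (λ_η) be nonnegative loop activities satisfying the symmetry assumption, let z ≥ 0, and let α(λ,z) = exp(μ_{λ,z}({0};{e})) where e is any vertex adjacent to 0 (this value is independent of the choice of e). Then for every y ∈ ℤ^d with y ≠ 0, G_{λ,z}(0,y) ≤ z·α(λ,z)·Σ_{u ∈ ℤ^d, ‖u‖_1 = 1} G_{λ,z}(u,y), as an inequality in [0,∞]. -/

import Mathlib

open scoped ENNReal NNReal BigOperators Classical

noncomputable section

namespace LWW

/-- A point of the lattice ℤ^d. -/
abbrev Pt (d : ℕ) := Fin d → ℤ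

/-- ℓ¹ distance on ℤ^d. -/
def dist1 {d : ℕ} (x y : Pt d) : ℕ := ∑ i, (x i - y i).natAbs

/-- Nearest-neighbour adjacency on ℤ^d. -/
def Adj {d : ℕ} (x y : Pt d) : Prop := dist1 x y = 1

/-- Auxiliary function for single loop erasure: scan the list, keeping the
self-avoiding prefix `pre`; when the first repeated vertex is met, return the
loop-erased list together with the removed loop. -/
def le1Aux {α : Type*} [DecidableEq α] : List α → List α → List α × Option (List α)
  | pre, [] => (pre, none)
  | pre, x :: rest =>
    if x ∈ pre then
      (pre.takeWhile (fun y => y ≠ x) ++ x :: rest,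
        some (pre.dropWhile (fun y => y ≠ x) ++ [x]))
    else le1Aux (pre ++ [x]) rest

/-- Single loop erasure LE¹. -/
def LE1 {α : Type*} [DecidableEq α] (l : List α) : List α := (le1Aux [] l).1

/-- The loop removed by a single loop erasure (if the list is not self-avoiding). -/
def removedLoop {α : Type*} [DecidableEq α] (l : List α) : Option (List α) := (le1Aux [] l).2

/-- Iterate single loop erasure (with fuel), collecting the multiset of removed loops. -/
def leAux {α : Type*} [DecidableEq α] : ℕ → List α → List α × Multiset (List α)
  | 0, l => (l, 0)
  | n + 1, l =>
    match le1Aux ([] : List α) l with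
    | (_, none) => (l, 0)
    | (l', some c) => ((leAux n l').1, c ::ₘ (leAux n l').2)

/-- Loop erasure LE. -/
def LE {α : Type*} [DecidableEq α] (l : List α) : List α := (leAux l.length l).1

/-- The multiset of loops removed by loop erasure. -/
def erasedLoops {α : Type*} [DecidableEq α] (l : List α) : Multiset (List α) :=
  (leAux l.length l).2

/-- The number of loops removed by loop erasure. -/
def nLoops {α : Type*} [DecidableEq α] (l : List α) : ℕ := Multiset.card (erasedLoops l)

/-- A (finite) nearest-neighbour walk on ℤ^d, recorded as its (nonempty) list of vertices. -/
structure Walk (d : ℕ) where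
  pts : List (Pt d)
  ne : pts ≠ []
  chain : pts.Chain' Adj

namespace Walk

variable {d : ℕ}

/-- The number of steps of a walk. -/
def len (ω : Walk d) : ℕ := ω.pts.length - 1

/-- The initial vertex of a walk. -/
def start (ω : Walk d) : Pt d := ω.pts.headI

/-- The final vertex of a walk. -/
def finish (ω : Walk d) : Pt d := ω.pts.getLastD default

/-- The range (set of visited vertices) of a walk. -/
def range (ω : Walk d) : Set (Pt d) := {x | x ∈ ω.pts}

/-- The `i`-th vertex of a walk. -/
def nth (ω : Walk d) (i : ℕ) : Pt d := ω.pts.getD i default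

/-- A walk is a loop if it has at least one step and ends where it began. -/
def IsLoop (ω : Walk d) : Prop := 1 ≤ ω.len ∧ ω.finish = ω.start

end Walk

/-- The list of vertices of a self-avoiding polygon: a closed nearest-neighbour
walk all of whose vertices are distinct except that the last equals the first. -/
def IsSAPList {d : ℕ} (l : List (Pt d)) : Prop :=
  l.Chain' Adj ∧ 3 ≤ l.length ∧ l.getLastD default = l.headI ∧ l.dropLast.Nodup

/-- Change the initial vertex of a polygon list by a cyclic rotation. -/
def polyRot {d : ℕ} (l : List (Pt d)) (r : ℕ) : List (Pt d) :=
  l.dropLast.rotate r ++ [(l.dropLast.rotate r).headI]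

/-- An isometry of the lattice ℤ^d: a bijection preserving ℓ¹ distance. -/
def IsLatticeIso {d : ℕ} (R : Pt d ≃ Pt d) : Prop :=
  ∀ x y : Pt d, dist1 (R x) (R y) = dist1 x y

/-- The symmetry assumption on the loop activities: invariance under isometries of ℤ^d
and under change of initial vertex and of orientation of the polygon. -/
def SymmAssumption {d : ℕ} (lam : List (Pt d) → ℝ≥0) : Prop :=
  (∀ R : Pt d ≃ Pt d, IsLatticeIso R → ∀ l : List (Pt d), IsSAPList l →
      lam (l.map R) = lam l) ∧
  (∀ l : List (Pt d), IsSAPList l → ∀ r : ℕ, lam (polyRot l r) = lam l) ∧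
  (∀ l : List (Pt d), IsSAPList l → lam l.reverse = lam l)

/-- The boundedness assumption: sup over self-avoiding polygons of the activity is finite. -/
def BoundedAssumption {d : ℕ} (lam : List (Pt d) → ℝ≥0) : Prop :=
  ∃ M : ℝ≥0, ∀ l : List (Pt d), IsSAPList l → lam l ≤ M

/-- The product of the loop activities over the loops erased from `ω`, i.e. λ^{n_L(ω)}. -/
def wt0 {d : ℕ} (lam : List (Pt d) → ℝ≥0) (ω : Walk d) : ℝ≥0∞ :=
  ((erasedLoops ω.pts).map (fun η => (lam η : ℝ≥0∞))).prod

/-- The λ-LWW weight w_{λ,z}(ω) = z^{|ω|} λ^{n_L(ω)}. -/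
def wt {d : ℕ} (lam : List (Pt d) → ℝ≥0) (z : ℝ≥0) (ω : Walk d) : ℝ≥0∞ :=
  (z : ℝ≥0∞) ^ ω.len * wt0 lam ω

/-- The λ-LWW two-point function. -/
def G {d : ℕ} (lam : List (Pt d) → ℝ≥0) (z : ℝ≥0) (x y : Pt d) : ℝ≥0∞ :=
  ∑' ω : Walk d, if ω.start = x ∧ ω.finish = y then wt lam z ω else 0

/-- The λ-LWW loop measure μ_{λ,z}(A;B). -/
def mu {d : ℕ} (lam : List (Pt d) → ℝ≥0) (z : ℝ≥0) (A B : Set (Pt d)) : ℝ≥0∞ :=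
  ∑' ω : Walk d,
    if ω.IsLoop ∧ (ω.range ∩ A).Nonempty ∧ ω.range ∩ B = ∅
    then wt lam z ω / (ω.len : ℝ≥0∞) else 0

/-- The generalized λ-LWW loop measure μ_{λ,z}(A,B;C) with two hitting sets. -/
def mu2 {d : ℕ} (lam : List (Pt d) → ℝ≥0) (z : ℝ≥0) (A B C : Set (Pt d)) : ℝ≥0∞ :=
  ∑' ω : Walk d,
    if ω.IsLoop ∧ (ω.range ∩ A).Nonempty ∧ (ω.range ∩ B).Nonempty ∧ ω.range ∩ C = ∅
    then wt lam z ω / (ω.len : ℝ≥0∞) else 0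

/-- exp : [0,∞] → [0,∞] with exp(∞) = ∞. -/
def eexp (x : ℝ≥0∞) : ℝ≥0∞ := if x = ⊤ then ⊤ else ENNReal.ofReal (Real.exp x.toReal)

/-- The loop-erased λ-LWW weight w̄_{λ,z}(η) of a self-avoiding walk η. -/
def wbar {d : ℕ} (lam : List (Pt d) → ℝ≥0) (z : ℝ≥0) (η : Walk d) : ℝ≥0∞ :=
  ∑' ω : Walk d, if LE ω.pts = η.pts then wt lam z ω else 0

/-- c_n^λ : the total λ-LWW mass of n-step walks started at the origin. -/
def cN {d : ℕ} (lam : List (Pt d) → ℝ≥0) (n : ℕ) : ℝ≥0∞ :=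
  ∑' ω : Walk d, if ω.start = 0 ∧ ω.len = n then wt0 lam ω else 0

/-- The susceptibility χ_λ(z) = Σ_n c_n^λ z^n. -/
def chi {d : ℕ} (lam : List (Pt d) → ℝ≥0) (z : ℝ) : ℝ≥0∞ :=
  ∑' n : ℕ, cN lam n * ENNReal.ofReal z ^ n

/-- The critical point z_c(λ): the radius of convergence of the susceptibility
(for a power series with nonnegative coefficients this is the supremum of the
set of nonnegative z at which the series converges). -/
def zc {d : ℕ} (lam : List (Pt d) → ℝ≥0) : ℝ :=
  sSup {z : ℝ | 0 ≤ z ∧ chi lam z < ⊤}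


section LoopErasure

variable {α : Type*} [DecidableEq α]

/-- Loop erasure run as a stack machine: `pre` is the current loop-erased path and the vertices of
the second list are read one after the other. Returns the final path and the erased loops. -/
def eraseRun : List α → List α → List α × Multiset (List α)
  | pre, [] => (pre, 0)
  | pre, x :: rest =>
    if x ∈ pre then
      ((eraseRun (pre.takeWhile (fun y => y ≠ x) ++ [x]) rest).1,
        (pre.dropWhile (fun y => y ≠ x) ++ [x]) ::ₘ
          (eraseRun (pre.takeWhile (fun y => y ≠ x) ++ [x]) rest).2)
    else eraseRun (pre ++ [x]) rest

theorem takeWhile_ne_append_cons {x : α} {t : List α} (hx : x ∉ t) (s : List α) :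
    (t ++ x :: s).takeWhile (fun y => y ≠ x) = t := by
  rw [List.takeWhile_append_of_pos]
  · simp
  · intro a ha
    simpa using fun h : a = x => hx (h ▸ ha)

theorem dropWhile_ne_append_cons {x : α} {t : List α} (hx : x ∉ t) (s : List α) :
    (t ++ x :: s).dropWhile (fun y => y ≠ x) = x :: s := by
  rw [List.dropWhile_append_of_pos]
  · simp
  · intro a ha
    simpa using fun h : a = x => hx (h ▸ ha)

@[simp] theorem eraseRun_nil (pre : List α) : eraseRun pre [] = (pre, 0) := by
  rw [eraseRun]

theorem eraseRun_cons_of_notMem {pre : List α} {x : α} (hx : x ∉ pre) (rest : List α) :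
    eraseRun pre (x :: rest) = eraseRun (pre ++ [x]) rest := by
  rw [eraseRun, if_neg hx]

theorem eraseRun_pop {x : α} {t : List α} (hx : x ∉ t) (s rest : List α) :
    eraseRun (t ++ x :: s) (x :: rest) =
      ((eraseRun (t ++ [x]) rest).1, (x :: s ++ [x]) ::ₘ (eraseRun (t ++ [x]) rest).2) := by
  rw [eraseRun, if_pos (by simp), takeWhile_ne_append_cons hx, dropWhile_ne_append_cons hx]

theorem nodup_append_singleton {β : Type*} {l : List β} (hl : l.Nodup) {x : β} (hx : x ∉ l) :
    (l ++ [x]).Nodup := by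
  rw [List.nodup_append]
  exact ⟨hl, by simp, by rintro a ha b hb rfl; simp at hb; exact hx (hb ▸ ha)⟩

theorem isChain_pop {β : Type*} {R : β → β → Prop} {x : β} {t s rest : List β}
    (h : (t ++ x :: s ++ x :: rest).IsChain R) :
    (x :: s ++ [x]).IsChain R ∧ (t ++ [x] ++ rest).IsChain R := by
  rw [List.append_assoc, List.cons_append, List.isChain_split] at h
  have h2 := List.isChain_split.1 (show (x :: s ++ x :: rest).IsChain R from h.2)
  refine ⟨h2.1, ?_⟩
  rw [List.append_assoc, List.singleton_append, List.isChain_split]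
  exact ⟨h.1, h2.2⟩

theorem le1Aux_append {pre : List α} (l rest : List α) (h : (pre ++ l).Nodup) :
    le1Aux pre (l ++ rest) = le1Aux (pre ++ l) rest := by
  induction l generalizing pre with
  | nil => simp
  | cons a l ih =>
    have ha : a ∉ pre := by
      intro hm
      exact (List.nodup_append.1 h).2.2 a hm a (by simp) rfl
    rw [List.cons_append, le1Aux, if_neg ha, ih (by simpa using h)]
    simp

theorem leAux_append {n : ℕ} {pre rest : List α} (h : pre.Nodup) (hn : rest.length ≤ n) :
    leAux n (pre ++ rest) = eraseRun pre rest := by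
  induction rest generalizing n pre with
  | nil =>
    cases n with
    | zero => simp [leAux]
    | succ n =>
      rw [leAux, le1Aux_append (pre := []) pre [] (by simpa using h)]
      simp [le1Aux]
  | cons x rest ih =>
    by_cases hx : x ∈ pre
    · obtain ⟨t, s, rfl, ht⟩ := List.eq_append_cons_of_mem hx
      cases n with
      | zero => simp at hn
      | succ n =>
        rw [leAux, le1Aux_append (pre := []) _ _ (by simpa using h), eraseRun_pop ht]
        have hnd : (t ++ [x]).Nodup := by
          refine h.sublist ?_
          simp
        have := ih (n := n) hnd (by simpa using hn)
        simp only [List.append_assoc, List.singleton_append] at this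
        simp only [le1Aux, List.nil_append, hx, if_true, takeWhile_ne_append_cons ht,
          dropWhile_ne_append_cons ht, this]
    · rw [eraseRun_cons_of_notMem hx, ← ih (n := n) (pre := pre ++ [x])]
      · simp
      · exact nodup_append_singleton h hx
      · simp at hn
        omega

theorem leAux_length (l : List α) : leAux l.length l = eraseRun [] l :=
  leAux_append (pre := []) List.nodup_nil le_rfl

theorem LE_eq (l : List α) : LE l = (eraseRun [] l).1 := by rw [LE, leAux_length]

theorem erasedLoops_eq (l : List α) : erasedLoops l = (eraseRun [] l).2 := by
  rw [erasedLoops, leAux_length]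

theorem eraseRun_append (pre a b : List α) :
    eraseRun pre (a ++ b) =
      ((eraseRun (eraseRun pre a).1 b).1,
        (eraseRun pre a).2 + (eraseRun (eraseRun pre a).1 b).2) := by
  induction a generalizing pre with
  | nil => simp
  | cons x a ih =>
    by_cases hx : x ∈ pre
    · obtain ⟨t, s, rfl, ht⟩ := List.eq_append_cons_of_mem hx
      rw [List.cons_append, eraseRun_pop ht, eraseRun_pop ht, ih]
      simp
    · rw [List.cons_append, eraseRun_cons_of_notMem hx, eraseRun_cons_of_notMem hx, ih]

/-- A vertex which is not met again can be put in front. -/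
theorem eraseRun_cons_pre {x : α} {rest : List α} (hx : x ∉ rest) (pre : List α) :
    eraseRun (x :: pre) rest = (x :: (eraseRun pre rest).1, (eraseRun pre rest).2) := by
  induction rest generalizing pre with
  | nil => simp
  | cons v rest ih =>
    simp only [List.mem_cons, not_or] at hx
    by_cases hv : v ∈ pre
    · obtain ⟨t, s, rfl, ht⟩ := List.eq_append_cons_of_mem hv
      have h := eraseRun_pop (x := v) (t := x :: t) (by simp [ht, Ne.symm hx.1]) s rest
      rw [List.cons_append] at h
      rw [h, eraseRun_pop ht, List.cons_append, ih hx.2]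
    · rw [eraseRun_cons_of_notMem hv, eraseRun_cons_of_notMem (by simp [hv, Ne.symm hx.1]),
        List.cons_append, ih hx.2]

theorem exists_eraseRun_eq_cons (x : α) (pre rest : List α) :
    ∃ s, (eraseRun (x :: pre) rest).1 = x :: s := by
  induction rest generalizing pre with
  | nil => simp
  | cons v rest ih =>
    by_cases hv : v ∈ x :: pre
    · obtain ⟨t, s, h, ht⟩ := List.eq_append_cons_of_mem hv
      rw [h, eraseRun_pop ht]
      cases t with
      | nil =>
        simp only [List.nil_append, List.cons.injEq] at h
        rw [← h.1]
        simpa using ih []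
      | cons a t =>
        simp only [List.cons_append, List.cons.injEq] at h
        rw [← h.1]
        simpa using ih (t ++ [v])
    · rw [eraseRun_cons_of_notMem hv]
      exact ih _

/-- `p` is the tail of a (possibly trivial) closed walk started at `x`. -/
def ClosedTail (x : α) (p : List α) : Prop := p = [] ∨ ∃ q, p = q ++ [x]

theorem eraseRun_closedTail {x : α} {p : List α} (h : ClosedTail x p) :
    (eraseRun [x] p).1 = [x] := by
  obtain rfl | ⟨q, rfl⟩ := h
  · simp
  · obtain ⟨s, hs⟩ := exists_eraseRun_eq_cons x [] q
    rw [eraseRun_append, hs]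
    have := eraseRun_pop (x := x) (t := []) (by simp) s []
    simp only [List.nil_append] at this
    rw [this]
    simp

theorem erasedLoops_cons (x : α) (p : List α) : erasedLoops (x :: p) = (eraseRun [x] p).2 := by
  rw [erasedLoops_eq, eraseRun_cons_of_notMem (by simp)]
  simp

theorem LE_cons (x : α) (p : List α) : LE (x :: p) = (eraseRun [x] p).1 := by
  rw [LE_eq, eraseRun_cons_of_notMem (by simp)]
  simp

@[simp] theorem LE_nil : LE ([] : List α) = [] := by simp [LE_eq]

@[simp] theorem erasedLoops_nil : erasedLoops ([] : List α) = 0 := by simp [erasedLoops_eq]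

@[simp] theorem erasedLoops_singleton (x : α) : erasedLoops [x] = 0 := by simp [erasedLoops_cons]

theorem erasedLoops_closedTail_append {x : α} {a : List α} (ha : ClosedTail x a) (b : List α) :
    erasedLoops (x :: (a ++ b)) = erasedLoops (x :: a) + erasedLoops (x :: b) := by
  simp [erasedLoops_cons, eraseRun_append, eraseRun_closedTail ha]

theorem LE_closedTail_append {x : α} {a : List α} (ha : ClosedTail x a) (b : List α) :
    LE (x :: (a ++ b)) = LE (x :: b) := by
  simp [LE_cons, eraseRun_append, eraseRun_closedTail ha]

theorem erasedLoops_cons_of_notMem {x : α} {p : List α} (hx : x ∉ p) :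
    erasedLoops (x :: p) = erasedLoops p := by
  rw [erasedLoops_cons, eraseRun_cons_pre hx, erasedLoops_eq]

theorem LE_cons_of_notMem {x : α} {p : List α} (hx : x ∉ p) : LE (x :: p) = x :: LE p := by
  rw [LE_cons, eraseRun_cons_pre hx, LE_eq]

/-- The loops erased from a closed walk returning once to its initial vertex. -/
theorem erasedLoops_firstReturn {x : α} {q : List α} (hx : x ∉ q) :
    erasedLoops (x :: (q ++ [x])) = (x :: LE q ++ [x]) ::ₘ erasedLoops q := by
  have h := eraseRun_pop (x := x) (t := []) (by simp) (LE q) []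
  simp only [List.nil_append] at h
  rw [erasedLoops_cons, eraseRun_append, eraseRun_cons_pre hx, ← LE_eq, ← erasedLoops_eq, h]
  simp [add_comm, ← Multiset.singleton_add]

theorem eraseRun_invariant {R : α → α → Prop} {pre rest : List α} (hnd : pre.Nodup)
    (hc : (pre ++ rest).IsChain R) :
    (eraseRun pre rest).1.Nodup ∧ (eraseRun pre rest).1 ⊆ pre ++ rest ∧
      (eraseRun pre rest).1.IsChain R ∧ (eraseRun pre rest).1.head? = (pre ++ rest).head? ∧
      (eraseRun pre rest).1.getLast? = (pre ++ rest).getLast? := by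
  induction rest generalizing pre with
  | nil => simpa [hnd] using hc
  | cons x rest ih =>
    by_cases hx : x ∈ pre
    · obtain ⟨t, s, rfl, ht⟩ := List.eq_append_cons_of_mem hx
      rw [eraseRun_pop ht]
      have hnd' : (t ++ [x]).Nodup := hnd.sublist (by simp)
      have hc' := (isChain_pop hc).2
      obtain ⟨h1, h2, h3, h4, h5⟩ := ih hnd' hc'
      refine ⟨h1, fun a ha => ?_, h3, ?_, ?_⟩
      · have := h2 ha
        simp only [List.mem_append, List.mem_cons] at this ⊢
        tauto
      · rw [h4]
        cases t <;> simp
      · rw [h5]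
        simp [List.getLast?_cons, List.getLast?_append]
    · rw [eraseRun_cons_of_notMem hx]
      have := ih (pre := pre ++ [x]) (nodup_append_singleton hnd hx) (by simpa using hc)
      simpa using this

theorem LE_invariant {R : α → α → Prop} {l : List α} (hc : l.IsChain R) :
    (LE l).Nodup ∧ LE l ⊆ l ∧ (LE l).IsChain R ∧ (LE l).head? = l.head? ∧
      (LE l).getLast? = l.getLast? := by
  rw [LE_eq]
  exact eraseRun_invariant (pre := []) List.nodup_nil hc

theorem eraseRun_map {β : Type*} [DecidableEq β] {f : α → β} (hf : Function.Injective f)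
    (pre rest : List α) :
    eraseRun (pre.map f) (rest.map f) =
      ((eraseRun pre rest).1.map f, (eraseRun pre rest).2.map (List.map f)) := by
  induction rest generalizing pre with
  | nil => simp
  | cons x rest ih =>
    by_cases hx : x ∈ pre
    · obtain ⟨t, s, rfl, ht⟩ := List.eq_append_cons_of_mem hx
      have ht' : f x ∉ t.map f := by simpa [hf.eq_iff] using ht
      have h := ih (t ++ [x])
      simp only [List.map_append, List.map_cons, List.map_nil] at h
      rw [eraseRun_pop ht, List.map_append, List.map_cons, List.map_cons, eraseRun_pop ht', h]
      simp
    · have hx' : f x ∉ pre.map f := by simpa [hf.eq_iff] using hx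
      have h := ih (pre ++ [x])
      simp only [List.map_append, List.map_cons, List.map_nil] at h
      rw [eraseRun_cons_of_notMem hx, List.map_cons, eraseRun_cons_of_notMem hx', h]

theorem erasedLoops_map {β : Type*} [DecidableEq β] {f : α → β} (hf : Function.Injective f)
    (l : List α) : erasedLoops (l.map f) = (erasedLoops l).map (List.map f) := by
  have := eraseRun_map hf [] l
  rw [List.map_nil] at this
  rw [erasedLoops_eq, this, erasedLoops_eq]

theorem erasedLoop_spec {R : α → α → Prop} {pre rest c : List α} (hnd : pre.Nodup)
    (hc : (pre ++ rest).IsChain R) (h : c ∈ (eraseRun pre rest).2) :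
    ∃ x s, c = x :: s ++ [x] ∧ (x :: s).Nodup ∧ c.IsChain R := by
  induction rest generalizing pre with
  | nil => simp at h
  | cons x rest ih =>
    by_cases hx : x ∈ pre
    · obtain ⟨t, s, rfl, ht⟩ := List.eq_append_cons_of_mem hx
      rw [eraseRun_pop ht, Multiset.mem_cons] at h
      obtain rfl | h := h
      · refine ⟨x, s, rfl, (List.nodup_append.1 hnd).2.1, ?_⟩
        exact (isChain_pop hc).1
      · exact ih (hnd.sublist (by simp)) (isChain_pop hc).2 h
    · rw [eraseRun_cons_of_notMem hx] at h
      exact ih (nodup_append_singleton hnd hx) (by simpa using hc) h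

end LoopErasure

section GeneratingFunction

open PowerSeries

variable {ι κ : Type*}

/-- The generating function of a nonnegative weight on a graded family. -/
def gf (deg : ι → ℕ) (f : ι → ℝ≥0∞) : PowerSeries ℝ≥0∞ :=
  PowerSeries.mk fun n => ∑' i, if deg i = n then f i else 0

theorem coeff_gf (deg : ι → ℕ) (f : ι → ℝ≥0∞) (n : ℕ) :
    coeff n (gf deg f) = ∑' i, if deg i = n then f i else 0 := coeff_mk _ _

theorem gf_mul (d₁ : ι → ℕ) (d₂ : κ → ℕ) (f : ι → ℝ≥0∞) (g : κ → ℝ≥0∞) :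
    gf d₁ f * gf d₂ g = gf (fun p : ι × κ => d₁ p.1 + d₂ p.2) (fun p => f p.1 * g p.2) := by
  ext n
  rw [coeff_mul, coeff_gf]
  simp only [coeff_gf]
  have h : ∀ p : ℕ × ℕ, (∑' i, if d₁ i = p.1 then f i else 0) * (∑' j, if d₂ j = p.2 then g j else 0)
      = ∑' q : ι × κ, (if d₁ q.1 = p.1 then f q.1 else 0) * (if d₂ q.2 = p.2 then g q.2 else 0) := by
    intro p
    rw [ENNReal.tsum_prod (f := fun i j => (if d₁ i = p.1 then f i else 0) *
      (if d₂ j = p.2 then g j else 0)), ← ENNReal.tsum_mul_right]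
    simp only [ENNReal.tsum_mul_left]
  simp only [h]
  rw [← Summable.tsum_finsetSum fun _ _ => ENNReal.summable]
  refine tsum_congr fun q => ?_
  by_cases hq : d₁ q.1 + d₂ q.2 = n
  · rw [if_pos hq, Finset.sum_eq_single (d₁ q.1, d₂ q.2)]
    · simp
    · rintro ⟨a, b⟩ - hab
      by_cases h1 : d₁ q.1 = a
      · by_cases h2 : d₂ q.2 = b
        · exact absurd (by rw [h1, h2]) hab
        · simp [h2]
      · simp [h1]
    · intro hn
      simp [hq] at hn
  · rw [if_neg hq]
    refine Finset.sum_eq_zero fun p hp => ?_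
    rw [Finset.HasAntidiagonal.mem_antidiagonal] at hp
    by_cases h1 : d₁ q.1 = p.1
    · by_cases h2 : d₂ q.2 = p.2
      · exact absurd (by rw [h1, h2, hp]) hq
      · simp [h2]
    · simp [h1]

theorem gf_add_deg (deg : ι → ℕ) (f : ι → ℝ≥0∞) (k : ℕ) :
    gf (fun i => deg i + k) f = X ^ k * gf deg f := by
  ext n
  rw [coeff_X_pow_mul', coeff_gf]
  split_ifs with h
  · rw [coeff_gf]
    refine tsum_congr fun i => ?_
    congr 1
    simp only [eq_iff_iff]
    omega
  · rw [ENNReal.tsum_eq_zero]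
    intro i
    rw [if_neg]
    omega

theorem gf_add (deg : ι → ℕ) (f g : ι → ℝ≥0∞) :
    gf deg (fun i => f i + g i) = gf deg f + gf deg g := by
  ext n
  simp only [map_add, coeff_gf]
  rw [← ENNReal.tsum_add]
  refine tsum_congr fun i => ?_
  split_ifs <;> simp

theorem gf_const_mul (deg : ι → ℕ) (c : ℝ≥0∞) (f : ι → ℝ≥0∞) :
    gf deg (fun i => c * f i) = C c * gf deg f := by
  ext n
  simp only [coeff_C_mul, coeff_gf]
  rw [← ENNReal.tsum_mul_left]
  refine tsum_congr fun i => ?_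
  split_ifs <;> simp

theorem gf_sum (deg : ι → ℕ) (s : Finset κ) (f : κ → ι → ℝ≥0∞) :
    gf deg (fun i => ∑ k ∈ s, f k i) = ∑ k ∈ s, gf deg (f k) := by
  ext n
  simp only [map_sum, coeff_gf]
  rw [← Summable.tsum_finsetSum fun _ _ => ENNReal.summable]
  refine tsum_congr fun i => ?_
  split_ifs <;> simp

/-- Transport of a generating function along a map that is injective on the support. -/
theorem gf_transport {d₁ : ι → ℕ} {d₂ : κ → ℕ} {f : ι → ℝ≥0∞} {g : κ → ℝ≥0∞} (φ : κ → ι)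
    (hinj : ∀ a b, g a ≠ 0 → g b ≠ 0 → φ a = φ b → a = b)
    (hsurj : ∀ i, f i ≠ 0 → ∃ a, g a ≠ 0 ∧ φ a = i)
    (hdeg : ∀ a, g a ≠ 0 → d₁ (φ a) = d₂ a) (hval : ∀ a, g a ≠ 0 → f (φ a) = g a) :
    gf d₁ f = gf d₂ g := by
  ext n
  rw [coeff_gf, coeff_gf]
  have key : ∀ a, (if d₂ a = n then g a else 0) ≠ 0 → d₂ a = n ∧ g a ≠ 0 := by
    intro a ha
    by_cases h : d₂ a = n
    · exact ⟨h, by simpa [h] using ha⟩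
    · simp [h] at ha
  refine tsum_eq_tsum_of_ne_zero_bij (fun a => φ a.1) ?_ ?_ ?_
  · intro a b hab
    exact Subtype.ext (hinj _ _ (key _ a.2).2 (key _ b.2).2 hab)
  · intro i hi
    rw [Function.mem_support] at hi
    by_cases h : d₁ i = n
    · rw [if_pos h] at hi
      obtain ⟨a, ha, rfl⟩ := hsurj i hi
      refine ⟨⟨a, ?_⟩, rfl⟩
      rw [Function.mem_support, if_pos ((hdeg a ha).symm.trans h)]
      exact ha
    · simp [h] at hi
  · intro a
    have ha := key _ a.2
    rw [hdeg _ ha.2, hval _ ha.2]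

theorem tsum_coeff_gf_mul (deg : ι → ℕ) (f : ι → ℝ≥0∞) (c : ℕ → ℝ≥0∞) :
    ∑' n, coeff n (gf deg f) * c n = ∑' i, f i * c (deg i) := by
  simp only [coeff_gf, ← ENNReal.tsum_mul_right]
  rw [ENNReal.tsum_comm]
  refine tsum_congr fun i => ?_
  rw [tsum_eq_single (deg i)]
  · simp
  · intro n hn
    simp [Ne.symm hn]

/-- Evaluation of a power series with coefficients in `[0,∞]`. -/
def ev (z : ℝ≥0∞) (p : PowerSeries ℝ≥0∞) : ℝ≥0∞ := ∑' n, coeff n p * z ^ n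

theorem ev_gf (z : ℝ≥0∞) (deg : ι → ℕ) (f : ι → ℝ≥0∞) :
    ev z (gf deg f) = ∑' i, f i * z ^ deg i :=
  tsum_coeff_gf_mul deg f fun n => z ^ n

theorem gf_coeff (p : PowerSeries ℝ≥0∞) : gf id (fun n => coeff n p) = p := by
  ext n
  rw [coeff_gf, tsum_eq_single n]
  · simp
  · intro m hm
    simp [hm]

theorem ev_mul (z : ℝ≥0∞) (p q : PowerSeries ℝ≥0∞) : ev z (p * q) = ev z p * ev z q := by
  conv_lhs => rw [← gf_coeff p, ← gf_coeff q, gf_mul, ev_gf]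
  rw [ENNReal.tsum_prod (f := fun i j => coeff i p * coeff j q * z ^ (id i + id j)), ev, ev,
    ← ENNReal.tsum_mul_right]
  refine tsum_congr fun i => ?_
  rw [← ENNReal.tsum_mul_left]
  refine tsum_congr fun j => ?_
  rw [id, id, pow_add]
  ring

theorem ev_sum (z : ℝ≥0∞) (s : Finset κ) (p : κ → PowerSeries ℝ≥0∞) :
    ev z (∑ k ∈ s, p k) = ∑ k ∈ s, ev z (p k) := by
  simp only [ev, map_sum, Finset.sum_mul]
  exact Summable.tsum_finsetSum fun _ _ => ENNReal.summable

/-- Lift of a power series with finite coefficients. -/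
theorem exists_map_eq {p : PowerSeries ℝ≥0∞} (h : ∀ n, coeff n p ≠ ⊤) :
    ∃ q : PowerSeries ℝ≥0, PowerSeries.map ENNReal.ofNNRealHom q = p := by
  refine ⟨PowerSeries.mk fun n => (coeff n p).toNNReal, ?_⟩
  ext n
  simp [ENNReal.coe_toNNReal (h n)]

/-- Power series with finite coefficients. -/
def finiteSeries : Subsemiring (PowerSeries ℝ≥0∞) :=
  (PowerSeries.map ENNReal.ofNNRealHom).rangeS

theorem mem_finiteSeries {p : PowerSeries ℝ≥0∞} : p ∈ finiteSeries ↔ ∀ n, coeff n p ≠ ⊤ := by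
  constructor
  · rintro ⟨q, rfl⟩ n
    simp
  · exact exists_map_eq

/-- The real power series with the same coefficients. -/
def toRealSeries (p : PowerSeries ℝ≥0∞) : PowerSeries ℝ := PowerSeries.mk fun n => (coeff n p).toReal

@[simp] theorem coeff_toRealSeries (p : PowerSeries ℝ≥0∞) (n : ℕ) :
    coeff n (toRealSeries p) = (coeff n p).toReal := coeff_mk _ _

theorem toRealSeries_map (q : PowerSeries ℝ≥0) :
    toRealSeries (PowerSeries.map ENNReal.ofNNRealHom q) = PowerSeries.map NNReal.toRealHom q := by
  ext n
  simp

theorem toRealSeries_mul {p q : PowerSeries ℝ≥0∞} (hp : p ∈ finiteSeries)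
    (hq : q ∈ finiteSeries) : toRealSeries (p * q) = toRealSeries p * toRealSeries q := by
  obtain ⟨p, rfl⟩ := hp
  obtain ⟨q, rfl⟩ := hq
  rw [toRealSeries_map p, toRealSeries_map q, ← map_mul (PowerSeries.map ENNReal.ofNNRealHom),
    toRealSeries_map, map_mul]

theorem toRealSeries_add {p q : PowerSeries ℝ≥0∞} (hp : p ∈ finiteSeries)
    (hq : q ∈ finiteSeries) : toRealSeries (p + q) = toRealSeries p + toRealSeries q := by
  obtain ⟨p, rfl⟩ := hp
  obtain ⟨q, rfl⟩ := hq
  rw [toRealSeries_map p, toRealSeries_map q, ← map_add (PowerSeries.map ENNReal.ofNNRealHom),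
    toRealSeries_map, map_add]

@[simp] theorem toRealSeries_one : toRealSeries 1 = 1 := by
  rw [← map_one (PowerSeries.map ENNReal.ofNNRealHom), toRealSeries_map, map_one]

@[simp] theorem toRealSeries_zero : toRealSeries 0 = 0 := by
  rw [← map_zero (PowerSeries.map ENNReal.ofNNRealHom), toRealSeries_map, map_zero]

theorem toRealSeries_sum {s : Finset κ} {p : κ → PowerSeries ℝ≥0∞}
    (hp : ∀ k ∈ s, p k ∈ finiteSeries) :
    toRealSeries (∑ k ∈ s, p k) = ∑ k ∈ s, toRealSeries (p k) := by
  induction s using Finset.induction_on with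
  | empty => simp
  | insert a s ha ih =>
    rw [Finset.sum_insert ha, Finset.sum_insert ha, toRealSeries_add (hp _ (by simp))
      (sum_mem fun k hk => hp k (by simp [hk])), ih fun k hk => hp k (by simp [hk])]

@[simp] theorem toRealSeries_X_pow (n : ℕ) : toRealSeries (X ^ n) = X ^ n := by
  rw [← PowerSeries.map_X ENNReal.ofNNRealHom, ← map_pow, toRealSeries_map, map_pow,
    PowerSeries.map_X]

theorem toRealSeries_C (c : ℝ≥0) : toRealSeries (C (c : ℝ≥0∞)) = C (c : ℝ) := by
  have : C (c : ℝ≥0∞) = PowerSeries.map ENNReal.ofNNRealHom (C c) := by simp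
  rw [this, toRealSeries_map]
  simp

theorem X_pow_mem_finiteSeries (n : ℕ) : (X ^ n : PowerSeries ℝ≥0∞) ∈ finiteSeries :=
  ⟨X ^ n, by simp⟩

theorem C_mem_finiteSeries (c : ℝ≥0) : C (c : ℝ≥0∞) ∈ finiteSeries :=
  ⟨C c, by simp⟩

theorem toRealSeries_inj {p q : PowerSeries ℝ≥0∞} (hp : p ∈ finiteSeries)
    (hq : q ∈ finiteSeries) (h : toRealSeries p = toRealSeries q) : p = q := by
  ext n
  have := congrArg (coeff n) h
  rw [coeff_toRealSeries, coeff_toRealSeries, ENNReal.toReal_eq_toReal_iff'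
    (mem_finiteSeries.1 hp n) (mem_finiteSeries.1 hq n)] at this
  exact this

/-- The solution of the renewal equation inherits finiteness of coefficients. -/
theorem renewal_mem_finiteSeries {F B : PowerSeries ℝ≥0∞} (hF : F ∈ finiteSeries)
    (h0 : coeff 0 F = 0) (hB : B = 1 + F * B) : B ∈ finiteSeries := by
  rw [mem_finiteSeries] at hF ⊢
  intro n
  induction n using Nat.strong_induction_on with
  | _ n ih =>
    rw [hB, map_add, coeff_mul, coeff_one]
    refine ENNReal.add_ne_top.2 ⟨by split_ifs <;> simp, ?_⟩
    rw [← lt_top_iff_ne_top, ENNReal.sum_lt_top]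
    rintro ⟨i, j⟩ hij
    rw [Finset.HasAntidiagonal.mem_antidiagonal] at hij
    rcases Nat.eq_zero_or_pos i with rfl | hi
    · simp [h0]
    · exact ENNReal.mul_lt_top (hF i).lt_top (ih j (by simp at hij; omega)).lt_top

end GeneratingFunction

section WalkSeries

open PowerSeries

variable {α : Type*} [DecidableEq α]

omit [DecidableEq α] in
theorem ClosedTail.isChain_append_iff {R : α → α → Prop} {x : α} {a : List α}
    (ha : ClosedTail x a) (b : List α) :
    (x :: (a ++ b)).IsChain R ↔ (x :: a).IsChain R ∧ (x :: b).IsChain R := by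
  obtain rfl | ⟨q, rfl⟩ := ha
  · simp
  · rw [List.append_assoc, List.singleton_append]
    exact List.isChain_split (l₁ := x :: q)

omit [DecidableEq α] in
theorem closedTail_iff {x : α} {p : List α} :
    ClosedTail x p ↔ p = [] ∨ p.getLast? = some x := by
  rw [ClosedTail, List.getLast?_eq_some_iff]

omit [DecidableEq α] in
theorem closedTail_append_cons {x : α} (q p : List α) :
    ClosedTail x (q ++ x :: p) ↔ ClosedTail x p := by
  rw [closedTail_iff, closedTail_iff]
  rcases List.eq_nil_or_concat p with rfl | ⟨p, y, rfl⟩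
  · simp
  · simp [List.getLast?_append, List.getLast?_cons]

theorem exists_closedTail_append (x : α) (p : List α) :
    ∃ a b, p = a ++ b ∧ ClosedTail x a ∧ x ∉ b := by
  induction p using List.reverseRecOn with
  | nil => exact ⟨[], [], rfl, Or.inl rfl, by simp⟩
  | append_singleton p v ih =>
    by_cases h : x = v
    · exact ⟨p ++ [v], [], by simp, Or.inr ⟨p, by rw [h]⟩, by simp⟩
    · obtain ⟨a, b, rfl, ha, hb⟩ := ih
      exact ⟨a, b ++ [v], by simp, ha, by simp [hb, h]⟩

omit [DecidableEq α] in
theorem closedTail_append_inj {x : α} {a b a' b' : List α} (ha : ClosedTail x a)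
    (ha' : ClosedTail x a') (hb : x ∉ b) (hb' : x ∉ b') (h : a ++ b = a' ++ b') :
    a = a' ∧ b = b' := by
  have key : ∀ {a c b : List α}, ClosedTail x (a ++ c) → x ∉ c ++ b → c = [] := by
    intro a c b hac hcb
    rcases List.eq_nil_or_concat c with rfl | ⟨c, y, rfl⟩
    · rfl
    · exfalso
      rcases hac with h | ⟨q, h⟩
      · simp at h
      · rw [List.concat_eq_append, ← List.append_assoc] at h
        have := List.append_inj_right' h (by simp)
        apply hcb
        simp at this
        simp [this]
  rcases List.append_eq_append_iff.1 h with ⟨c, rfl, rfl⟩ | ⟨c, rfl, rfl⟩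
  · obtain rfl := key ha' hb
    simp
  · obtain rfl := key ha hb'
    simp

variable (R : α → α → Prop) (lam : List α → ℝ≥0)

/-- The product of the activities of the loops erased from a list. -/
def loopWt (l : List α) : ℝ≥0∞ := ((erasedLoops l).map (fun η => (lam η : ℝ≥0∞))).prod

/-- The loop weight of a list, restricted to the walks of the relation `R`. -/
def walkWt (l : List α) : ℝ≥0∞ := if l.IsChain R then loopWt lam l else 0

/-- Generating function of the closed walks in `D` at `x`, described by their tails. -/
def loopSeries (D : Finset α) (x : α) : PowerSeries ℝ≥0∞ :=
  gf List.length fun p =>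
    if (∀ v ∈ p, v ∈ D) ∧ ClosedTail x p then walkWt R lam (x :: p) else 0

/-- Generating function of the closed walks in `D` returning to `x` exactly once. -/
def returnSeries (D : Finset α) (x : α) : PowerSeries ℝ≥0∞ :=
  gf (fun q => List.length q + 1) fun q =>
    if ∀ v ∈ q, v ∈ D.erase x then walkWt R lam (x :: (q ++ [x])) else 0

/-- Generating function, by number of vertices, of the walks in `D` with loop erasure `η`. -/
def pathSeries (D : Finset α) (η : List α) : PowerSeries ℝ≥0∞ :=
  gf List.length fun q => if (∀ v ∈ q, v ∈ D) ∧ LE q = η then walkWt R lam q else 0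

variable {R lam}

theorem isChain_of_walkWt_ne_zero {l : List α} (h : walkWt R lam l ≠ 0) : l.IsChain R := by
  by_contra hc
  exact h (if_neg hc)

theorem walkWt_closedTail_append {x : α} {a : List α} (ha : ClosedTail x a) (b : List α) :
    walkWt R lam (x :: (a ++ b)) = walkWt R lam (x :: a) * walkWt R lam (x :: b) := by
  simp only [walkWt, ha.isChain_append_iff, loopWt, erasedLoops_closedTail_append ha,
    Multiset.map_add, Multiset.prod_add]
  by_cases h1 : (x :: a).IsChain R <;> by_cases h2 : (x :: b).IsChain R <;> simp [h1, h2]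

theorem walkWt_cons {x : α} {q η : List α} (hx : x ∉ q) (hq : LE q = η)
    (hη : (x :: η).IsChain R) : walkWt R lam (x :: q) = walkWt R lam q := by
  rw [walkWt, walkWt, loopWt, erasedLoops_cons_of_notMem hx, ← loopWt]
  refine if_congr ?_ rfl rfl
  rw [List.isChain_cons]
  refine ⟨fun h => h.2, fun h => ⟨?_, h⟩⟩
  rw [← (LE_invariant h).2.2.2.1, hq]
  exact (List.isChain_cons.1 hη).1

theorem walkWt_firstReturn {x : α} {q : List α} (hx : x ∉ q) :
    walkWt R lam (x :: (q ++ [x])) =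
      if (x :: (LE q ++ [x])).IsChain R then lam (x :: (LE q ++ [x])) * walkWt R lam q else 0 := by
  by_cases hq : q.IsChain R
  · obtain ⟨-, -, h3, h4, h5⟩ := LE_invariant hq
    have h : (x :: (LE q ++ [x])).IsChain R ↔ (x :: (q ++ [x])).IsChain R := by
      simp only [List.isChain_cons, List.isChain_append, List.head?_append, h3, h4, h5, hq]
    rw [walkWt, walkWt, if_pos hq, loopWt, erasedLoops_firstReturn hx]
    refine if_congr h.symm ?_ rfl
    simp [loopWt]
  · have h : ¬ (x :: (q ++ [x])).IsChain R := fun h =>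
      hq (List.isChain_append.1 (List.isChain_cons.1 h).2).1
    simp [walkWt, hq, h]

@[simp] theorem walkWt_singleton (x : α) : walkWt R lam [x] = 1 := by simp [walkWt, loopWt]

@[simp] theorem walkWt_nil : walkWt R lam [] = 1 := by simp [walkWt, loopWt]

/-- The renewal equation for closed walks. -/
theorem loopSeries_eq {D : Finset α} {x : α} (hx : x ∈ D) :
    loopSeries R lam D x = 1 + returnSeries R lam D x * loopSeries R lam D x := by
  have hone : (1 : PowerSeries ℝ≥0∞) =
      gf List.length fun p : List α => if p = [] then 1 else 0 := by
    ext n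
    rw [coeff_gf, tsum_eq_single []]
    · simp [coeff_one, eq_comm]
    · intro p hp
      simp [hp]
  set f : List α → ℝ≥0∞ := fun p =>
    if (∀ v ∈ p, v ∈ D) ∧ ClosedTail x p then walkWt R lam (x :: p) else 0 with hf
  have hsplit : loopSeries R lam D x = gf List.length fun p : List α =>
      (if p = [] then 1 else 0) + if p = [] then 0 else f p := by
    rw [loopSeries]
    congr 1
    ext p
    by_cases hp : p = []
    · simp [hp, ClosedTail]
    · simp [hp, hf]
  conv_lhs => rw [hsplit, gf_add, ← hone]
  congr 1
  rw [loopSeries, returnSeries, gf_mul]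
  have hid : ∀ q p : List α, x ∉ q → (if q ++ x :: p = [] then 0 else f (q ++ x :: p)) =
      (if ∀ v ∈ q, v ∈ D.erase x then walkWt R lam (x :: (q ++ [x])) else 0) * f p := by
    intro q p hq
    have h1 : (q ++ x :: p) ≠ [] := by simp
    have h2 : (∀ v ∈ q, v ∈ D.erase x) ↔ ∀ v ∈ q, v ∈ D := by
      refine forall₂_congr fun v hv => ?_
      rw [Finset.mem_erase]
      exact and_iff_right fun h => hq (h ▸ hv)
    have h3 : (∀ v ∈ q ++ x :: p, v ∈ D) ↔ (∀ v ∈ q, v ∈ D) ∧ ∀ v ∈ p, v ∈ D := by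
      simp only [List.mem_append, List.mem_cons]
      constructor
      · exact fun h => ⟨fun v hv => h v (by simp [hv]), fun v hv => h v (by simp [hv])⟩
      · rintro ⟨ha, hb⟩ v (hv | rfl | hv)
        exacts [ha v hv, hx, hb v hv]
    have h4 : walkWt R lam (x :: (q ++ x :: p)) =
        walkWt R lam (x :: (q ++ [x])) * walkWt R lam (x :: p) := by
      rw [← walkWt_closedTail_append (Or.inr ⟨q, rfl⟩)]
      simp
    simp only [hf, if_neg h1, h2, h3, closedTail_append_cons, h4]
    rw [ite_and, ite_and, ite_and, ite_mul, zero_mul]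
    split_ifs <;> simp
  have hne : ∀ a : List α × List α, (if ∀ v ∈ a.1, v ∈ D.erase x then
      walkWt R lam (x :: (a.1 ++ [x])) else 0) * f a.2 ≠ 0 → x ∉ a.1 := by
    intro a ha hxa
    refine ha ?_
    rw [if_neg fun h => by simpa using h x hxa, zero_mul]
  refine gf_transport (fun a => a.1 ++ x :: a.2) ?_ ?_ ?_ ?_
  · intro a b ha hb hab
    have h := congrArg (List.takeWhile fun y => y ≠ x) hab
    simp only [takeWhile_ne_append_cons (hne a ha), takeWhile_ne_append_cons (hne b hb)] at h
    simp only [h, List.append_cancel_left_eq, List.cons.injEq, true_and] at hab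
    exact Prod.ext h hab
  · intro p hp
    have hp0 : p ≠ [] := fun h => by simp [h] at hp
    have hc : ClosedTail x p := by
      by_contra hc
      simp [hf, hc] at hp
    have hm : x ∈ p := by
      rcases hc with h | ⟨q, rfl⟩
      · exact absurd h hp0
      · simp
    obtain ⟨q, r, rfl, hq⟩ := List.eq_append_cons_of_mem hm
    refine ⟨(q, r), ?_, rfl⟩
    rw [hid q r hq] at hp
    exact hp
  · intro a _
    simp only [List.length_append, List.length_cons]
    omega
  · intro a ha
    exact hid _ _ (hne a ha)

/-- Last exit decomposition of the walks with a given loop erasure. -/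
theorem gf_tail_eq {D : Finset α} {x : α} {η : List α} (hη : (x :: η).IsChain R) :
    (gf List.length fun p =>
      if (∀ v ∈ p, v ∈ D) ∧ LE (x :: p) = x :: η then walkWt R lam (x :: p) else 0) =
      loopSeries R lam D x * pathSeries R lam (D.erase x) η := by
  rw [loopSeries, pathSeries, gf_mul]
  have hid : ∀ a q : List α, ClosedTail x a → x ∉ q →
      (if (∀ v ∈ a ++ q, v ∈ D) ∧ LE (x :: (a ++ q)) = x :: η then
        walkWt R lam (x :: (a ++ q)) else 0) =
      (if (∀ v ∈ a, v ∈ D) ∧ ClosedTail x a then walkWt R lam (x :: a) else 0) *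
        if (∀ v ∈ q, v ∈ D.erase x) ∧ LE q = η then walkWt R lam q else 0 := by
    intro a q ha hq
    have h2 : (∀ v ∈ q, v ∈ D.erase x) ↔ ∀ v ∈ q, v ∈ D := by
      refine forall₂_congr fun v hv => ?_
      rw [Finset.mem_erase]
      exact and_iff_right fun h => hq (h ▸ hv)
    have h3 : (∀ v ∈ a ++ q, v ∈ D) ↔ (∀ v ∈ a, v ∈ D) ∧ ∀ v ∈ q, v ∈ D := by
      simp only [List.mem_append, or_imp, forall_and]
    simp only [h2, h3]
    rw [LE_closedTail_append ha, LE_cons_of_notMem hq, walkWt_closedTail_append ha]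
    by_cases hE : LE q = η
    · rw [walkWt_cons hq hE hη]
      simp only [ha, hE, and_true]
      rw [ite_and, ite_mul, zero_mul]
      split_ifs <;> simp
    · simp [hE]
  have hne : ∀ a : List α × List α,
      (if (∀ v ∈ a.1, v ∈ D) ∧ ClosedTail x a.1 then walkWt R lam (x :: a.1) else 0) *
        (if (∀ v ∈ a.2, v ∈ D.erase x) ∧ LE a.2 = η then walkWt R lam a.2 else 0) ≠ 0 →
      ClosedTail x a.1 ∧ x ∉ a.2 := by
    intro a ha
    constructor
    · by_contra h
      simp [h] at ha
    · intro h
      refine ha ?_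
      rw [if_neg (c := _ ∧ LE a.2 = η) fun h' => by simpa using h'.1 x h, mul_zero]
  refine gf_transport (fun a => a.1 ++ a.2) ?_ ?_ ?_ ?_
  · intro a b ha hb hab
    have := closedTail_append_inj (hne a ha).1 (hne b hb).1 (hne a ha).2 (hne b hb).2 hab
    exact Prod.ext this.1 this.2
  · intro p hp
    obtain ⟨a, q, rfl, ha, hq⟩ := exists_closedTail_append x p
    refine ⟨(a, q), ?_, rfl⟩
    rw [hid a q ha hq] at hp
    exact hp
  · intro a _
    simp
  · intro a ha
    exact hid _ _ (hne a ha).1 (hne a ha).2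

theorem pathSeries_cons {D : Finset α} {x : α} {η : List α} (hx : x ∈ D)
    (hη : (x :: η).IsChain R) : pathSeries R lam D (x :: η) =
      X ^ 1 * (loopSeries R lam D x * pathSeries R lam (D.erase x) η) := by
  rw [← gf_tail_eq hη, ← gf_add_deg, pathSeries]
  refine gf_transport (fun p => x :: p) ?_ ?_ ?_ ?_
  · intro a b _ _ hab
    simpa using hab
  · intro q hq
    have hP : ((∀ v ∈ q, v ∈ D) ∧ LE q = x :: η) ∧ walkWt R lam q ≠ 0 := by
      simpa only [ne_eq, ite_eq_right_iff, Classical.not_imp] using hq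
    have h4 := (LE_invariant (isChain_of_walkWt_ne_zero hP.2)).2.2.2.1
    rw [hP.1.2] at h4
    cases q with
    | nil => simp at h4
    | cons y q =>
      simp only [List.head?_cons, Option.some.injEq] at h4
      subst h4
      refine ⟨q, ?_, rfl⟩
      rw [if_pos ⟨fun v hv => hP.1.1 v (by simp [hv]), hP.1.2⟩]
      exact hP.2
  · simp
  · intro a _
    refine if_congr ?_ rfl rfl
    simp [hx]

theorem pathSeries_nil (D : Finset α) : pathSeries R lam D [] = 1 := by
  ext n
  rw [pathSeries, coeff_gf, tsum_eq_single []]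
  · simp [coeff_one, eq_comm]
  · intro q hq
    by_contra h
    have hP : q.length = n ∧ ((∀ v ∈ q, v ∈ D) ∧ LE q = []) ∧ walkWt R lam q ≠ 0 := by
      simpa only [ne_eq, ite_eq_right_iff, Classical.not_imp] using h
    have h4 := (LE_invariant (isChain_of_walkWt_ne_zero hP.2.2)).2.2.2.1
    rw [hP.2.1.2] at h4
    cases q with
    | nil => exact hq rfl
    | cons y q => simp at h4

variable (R lam) in
/-- The product of the closed walk series along a path whose past is removed. -/
def loopProd : Finset α → List α → PowerSeries ℝ≥0∞
  | _, [] => 1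
  | D, u :: η => loopSeries R lam D u * loopProd (D.erase u) η

theorem pathSeries_eq {D : Finset α} {η : List α} (hη : η.IsChain R) (hnd : η.Nodup)
    (hD : ∀ v ∈ η, v ∈ D) : pathSeries R lam D η = X ^ η.length * loopProd R lam D η := by
  induction η generalizing D with
  | nil => simp [pathSeries_nil, loopProd]
  | cons x η ih =>
    rw [List.nodup_cons] at hnd
    rw [pathSeries_cons (hD x (by simp)) hη, ih (List.isChain_cons.1 hη).2 hnd.2, loopProd,
      List.length_cons, pow_succ]
    · ring
    · intro v hv
      rw [Finset.mem_erase]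
      exact ⟨fun h => hnd.1 (h ▸ hv), hD v (by simp [hv])⟩

/-- The self-avoiding lists in a finite set. -/
def nodupLists (D : Finset α) : Finset (List α) := D.powerset.biUnion fun S => S.val.lists.toFinset

theorem mem_nodupLists {D : Finset α} {l : List α} :
    l ∈ nodupLists D ↔ l.Nodup ∧ ∀ v ∈ l, v ∈ D := by
  simp only [nodupLists, Finset.mem_biUnion, Finset.mem_powerset, Multiset.mem_toFinset,
    Multiset.mem_lists_iff]
  constructor
  · rintro ⟨S, hS, h⟩
    have h' : S.val = (l : Multiset α) := h
    refine ⟨?_, fun v hv => hS ?_⟩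
    · rw [← Multiset.coe_nodup, ← h']
      exact S.nodup
    · rw [← Finset.mem_val, h']
      exact hv
  · rintro ⟨h1, h2⟩
    exact ⟨⟨l, h1⟩, fun v hv => h2 v hv, rfl⟩

theorem LE_mem_nodupLists {D : Finset α} {q : List α} (hq : ∀ v ∈ q, v ∈ D)
    (hw : walkWt R lam q ≠ 0) : LE q ∈ nodupLists D := by
  have h := LE_invariant (isChain_of_walkWt_ne_zero hw)
  exact mem_nodupLists.2 ⟨h.1, fun v hv => hq v (h.2.1 hv)⟩

theorem returnSeries_eq (D : Finset α) (x : α) :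
    returnSeries R lam D x = ∑ η ∈ nodupLists (D.erase x),
      if (x :: (η ++ [x])).IsChain R then
        X ^ 1 * (C (lam (x :: (η ++ [x])) : ℝ≥0∞) * pathSeries R lam (D.erase x) η) else 0 := by
  have h : ∀ η, (if (x :: (η ++ [x])).IsChain R then
        X ^ 1 * (C (lam (x :: (η ++ [x])) : ℝ≥0∞) * pathSeries R lam (D.erase x) η) else 0) =
      X ^ 1 * gf List.length fun q =>
        (if (x :: (η ++ [x])).IsChain R then (lam (x :: (η ++ [x])) : ℝ≥0∞) else 0) *
        if (∀ v ∈ q, v ∈ D.erase x) ∧ LE q = η then walkWt R lam q else 0 := by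
    intro η
    rw [gf_const_mul, ← pathSeries]
    split_ifs <;> simp
  simp only [h]
  rw [← Finset.mul_sum, ← gf_sum, ← gf_add_deg, returnSeries]
  congr 1
  ext q
  by_cases hq : ∀ v ∈ q, v ∈ D.erase x
  · have hx : x ∉ q := fun h => by simpa using hq x h
    rw [if_pos hq, walkWt_firstReturn hx, Finset.sum_eq_single (LE q)]
    · have h' : (∀ v ∈ q, v ∈ D.erase x) ∧ LE q = LE q := ⟨hq, rfl⟩
      rw [if_pos h']
      split_ifs <;> simp
    · intro η _ hη
      simp [Ne.symm hη]
    · intro hn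
      have : walkWt R lam q = 0 := by
        by_contra hw
        exact hn (LE_mem_nodupLists hq hw)
      simp [this]
  · rw [if_neg hq]
    refine (Finset.sum_eq_zero fun η _ => ?_).symm
    rw [if_neg (c := _ ∧ LE q = η) fun h => hq h.1, mul_zero]

end WalkSeries

section CycleGas

variable {α A : Type*} [DecidableEq α] [CommRing A]

/-- The families of pairwise disjoint nonempty subsets of `D`. -/
def disjointFamilies (D : Finset α) : Finset (Finset (Finset α)) :=
  D.powerset.powerset.filter fun F =>
    (∀ S ∈ F, S.Nonempty) ∧ (F : Set (Finset α)).PairwiseDisjoint id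

omit [DecidableEq α] in
theorem mem_disjointFamilies {D : Finset α} {F : Finset (Finset α)} :
    F ∈ disjointFamilies D ↔
      (∀ S ∈ F, S ⊆ D ∧ S.Nonempty) ∧ (F : Set (Finset α)).PairwiseDisjoint id := by
  simp only [disjointFamilies, Finset.mem_filter, Finset.mem_powerset, Finset.subset_iff (s₁ := F),
    forall_and, and_assoc]

/-- The alternating partition function of disjoint subsets of `D` with weights `V`. -/
def gasSum (V : Finset α → A) (D : Finset α) : A :=
  ∑ F ∈ disjointFamilies D, ∏ S ∈ F, -V S

omit [DecidableEq α] in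
theorem gasSum_empty (V : Finset α → A) : gasSum V ∅ = 1 := by
  have h : disjointFamilies (∅ : Finset α) = {∅} := by
    ext F
    rw [mem_disjointFamilies, Finset.mem_singleton]
    constructor
    · intro h
      refine Finset.eq_empty_of_forall_notMem fun S hS => ?_
      obtain ⟨h1, h2⟩ := h.1 S hS
      exact h2.ne_empty (Finset.subset_empty.1 h1)
    · rintro rfl
      simp
  simp [gasSum, h]

theorem filter_disjointFamilies (D : Finset α) (x : α) :
    (disjointFamilies D).filter (fun F => ¬ ∃ S ∈ F, x ∈ S) = disjointFamilies (D.erase x) := by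
  ext F
  simp only [Finset.mem_filter, mem_disjointFamilies, Finset.subset_erase, not_exists, not_and]
  constructor
  · exact fun h => ⟨fun S hS => ⟨⟨(h.1.1 S hS).1, h.2 S hS⟩, (h.1.1 S hS).2⟩, h.1.2⟩
  · exact fun h => ⟨⟨fun S hS => ⟨(h.1 S hS).1.1, (h.1 S hS).2⟩, h.2⟩, fun S hS => (h.1 S hS).1.2⟩

/-- Expansion of the partition function over the set covering a given point. -/
theorem gasSum_eq (V : Finset α → A) (D : Finset α) (x : α) :
    gasSum V D = gasSum V (D.erase x) -
      ∑ S ∈ D.powerset.filter (fun S => x ∈ S), V S * gasSum V (D \ S) := by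
  rw [gasSum, ← Finset.sum_filter_add_sum_filter_not _ (fun F => ∃ S ∈ F, x ∈ S),
    filter_disjointFamilies, ← gasSum, add_comm, sub_eq_add_neg]
  congr 1
  simp only [gasSum, Finset.mul_sum, ← Finset.sum_neg_distrib]
  rw [Finset.sum_sigma']
  have hS : ∀ {S : Finset α} {F}, x ∈ S → F ∈ disjointFamilies (D \ S) →
      ∀ T ∈ F, Disjoint S T := by
    intro S F _ hF T hT
    exact (Finset.disjoint_of_subset_left ((mem_disjointFamilies.1 hF).1 T hT).1
      Finset.sdiff_disjoint).symm
  have hmem : ∀ {S : Finset α} {F}, x ∈ S → F ∈ disjointFamilies (D \ S) → S ∉ F := by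
    intro S F hx hF h
    exact Finset.disjoint_left.1 (hS hx hF S h) hx hx
  symm
  refine Finset.sum_bij (fun a _ => insert a.1 a.2) ?_ ?_ ?_ ?_
  · rintro ⟨S, F⟩ h
    simp only [Finset.mem_sigma, Finset.mem_filter, Finset.mem_powerset] at h
    have hF := mem_disjointFamilies.1 h.2
    simp only [Finset.mem_filter, mem_disjointFamilies]
    refine ⟨⟨?_, ?_⟩, S, by simp, h.1.2⟩
    · intro T hT
      rcases Finset.mem_insert.1 hT with rfl | hT
      · exact ⟨h.1.1, x, h.1.2⟩
      · exact ⟨(hF.1 T hT).1.trans Finset.sdiff_subset, (hF.1 T hT).2⟩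
    · rw [Finset.coe_insert]
      exact hF.2.insert fun T hT _ => hS h.1.2 h.2 T hT
  · rintro ⟨S, F⟩ h ⟨S', F'⟩ h' hab
    simp only [Finset.mem_sigma, Finset.mem_filter, Finset.mem_powerset] at h h'
    have hSS : S = S' := by
      have : S ∈ insert S' F' := by
        rw [← hab]
        simp
      rcases Finset.mem_insert.1 this with h1 | h1
      · exact h1
      · exact absurd h.1.2 (Finset.disjoint_left.1 (hS h'.1.2 h'.2 S h1) h'.1.2)
    subst hSS
    have := congrArg (fun F => F.erase S) hab
    simp only [Finset.erase_insert (hmem h.1.2 h.2), Finset.erase_insert (hmem h.1.2 h'.2)] at this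
    rw [this]
  · intro F hF
    simp only [Finset.mem_filter, mem_disjointFamilies] at hF
    obtain ⟨⟨h1, h2⟩, S, hSF, hxS⟩ := hF
    refine ⟨⟨S, F.erase S⟩, ?_, Finset.insert_erase hSF⟩
    simp only [Finset.mem_sigma, Finset.mem_filter, Finset.mem_powerset, mem_disjointFamilies]
    refine ⟨⟨(h1 S hSF).1, hxS⟩, fun T hT => ?_, h2.subset (by simp)⟩
    have hT' := Finset.mem_erase.1 hT
    refine ⟨Finset.subset_sdiff.2 ⟨(h1 T hT'.2).1, ?_⟩, (h1 T hT'.2).2⟩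
    exact h2 hT'.2 hSF hT'.1
  · rintro ⟨S, F⟩ h
    simp only [Finset.mem_sigma, Finset.mem_filter, Finset.mem_powerset] at h
    rw [Finset.prod_insert (hmem h.1.2 h.2), neg_mul]

/-- Euler's identity for the partition function of disjoint subsets. -/
theorem derivation_gasSum {K : Type*} [CommRing K] [Algebra K A] (θ : Derivation K A A)
    (V : Finset α → A) (hV : ∀ S, θ (V S) = S.card • V S) (D : Finset α) :
    θ (gasSum V D) = ∑ v ∈ D, (gasSum V D - gasSum V (D.erase v)) := by
  have hprod : ∀ F : Finset (Finset α),
      θ (∏ S ∈ F, -V S) = (∑ S ∈ F, S.card) • ∏ S ∈ F, -V S := by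
    intro F
    induction F using Finset.induction_on with
    | empty => simp
    | insert S F hS ih =>
      rw [Finset.prod_insert hS, Finset.sum_insert hS, Derivation.leibniz, ih, map_neg, hV]
      simp only [smul_eq_mul, nsmul_eq_mul, Nat.cast_add]
      ring
  have hsub : ∀ v, gasSum V D - gasSum V (D.erase v) =
      ∑ F ∈ disjointFamilies D, if ∃ S ∈ F, v ∈ S then ∏ S ∈ F, -V S else 0 := by
    intro v
    rw [gasSum, gasSum, ← filter_disjointFamilies, sub_eq_iff_eq_add, ← Finset.sum_filter,
      Finset.sum_filter_add_sum_filter_not]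
  simp only [hsub]
  rw [Finset.sum_comm, gasSum, map_sum]
  refine Finset.sum_congr rfl fun F hF => ?_
  have hF' := mem_disjointFamilies.1 hF
  rw [hprod, ← Finset.sum_filter, Finset.sum_const]
  congr 1
  refine (Finset.card_biUnion hF'.2).symm.trans (congrArg _ ?_)
  ext v
  simp only [Finset.mem_biUnion, Finset.mem_filter, id]
  exact ⟨fun ⟨S, h, hv⟩ => ⟨(hF'.1 S h).1 hv, S, h, hv⟩, fun h => h.2⟩

end CycleGas

section CycleWeights

variable {α : Type*} [DecidableEq α] (R : α → α → Prop) (lam : List α → ℝ≥0)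

/-- The activity of the polygon obtained by closing up a list of vertices. -/
def cycleWt (l : List α) : ℝ := if (l ++ l.take 1).IsChain R then lam (l ++ l.take 1) else 0

/-- The total activity of the polygons with vertex set `S` rooted at `x`. -/
def cycleSum (S : Finset α) (x : α) : ℝ :=
  ∑ l ∈ (nodupLists S).filter (fun l => l.toFinset = S ∧ l.head? = some x), cycleWt R lam l

/-- The activities are invariant under a change of initial vertex. -/
def RotInvariant : Prop := ∀ l : List α, l.Nodup → (l ++ l.take 1).IsChain R → ∀ r : ℕ,
  lam (l.rotate r ++ (l.rotate r).take 1) = lam (l ++ l.take 1)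

variable {R lam}

omit [DecidableEq α] in
theorem isChain_closed_iff (l : List α) :
    (l ++ l.take 1).IsChain R ↔ Cycle.Chain R (l : Cycle α) := by
  cases l with
  | nil => simp
  | cons x l => simp [Cycle.chain_coe_cons]

omit [DecidableEq α] in
theorem isChain_closed_rotate (l : List α) (r : ℕ) :
    (l.rotate r ++ (l.rotate r).take 1).IsChain R ↔ (l ++ l.take 1).IsChain R := by
  rw [isChain_closed_iff, isChain_closed_iff]
  have : (l.rotate r : Cycle α) = l := Cycle.coe_eq_coe.2 ⟨l.length - r % l.length, by
    rw [← List.rotate_mod l r, List.rotate_rotate]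
    rcases Nat.eq_zero_or_pos l.length with h | h
    · simp [List.length_eq_zero_iff.1 h]
    · rw [Nat.add_sub_cancel' (Nat.mod_lt _ h).le, List.rotate_length]⟩
  rw [this]

omit [DecidableEq α] in
theorem RotInvariant.cycleWt_rotate (h : RotInvariant R lam) {l : List α} (hl : l.Nodup) (r : ℕ) :
    cycleWt R lam (l.rotate r) = cycleWt R lam l := by
  rw [cycleWt, cycleWt]
  by_cases hc : (l ++ l.take 1).IsChain R
  · rw [if_pos hc, if_pos ((isChain_closed_rotate l r).2 hc), h l hl hc]
  · rw [if_neg hc, if_neg (mt (isChain_closed_rotate l r).1 hc)]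

omit [DecidableEq α] in
theorem rotate_eq_self_of_head? {l : List α} (hl : l.Nodup) {n : ℕ}
    (h : (l.rotate n).head? = l.head?) : l.rotate n = l := by
  cases l with
  | nil => simp
  | cons x l =>
    have hn : n % (x :: l).length < (x :: l).length := Nat.mod_lt _ (by simp)
    rw [← List.rotate_mod, List.head?_rotate hn, List.getElem?_eq_getElem hn] at h
    have : n % (x :: l).length = 0 := by
      refine (hl.getElem_inj_iff (hi := hn) (hj := by simp)).1 ?_
      simpa using h
    rw [← List.rotate_mod, this, List.rotate_zero]

theorem head?_rotate_idxOf {l : List α} {y : α} (hy : y ∈ l) :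
    (l.rotate (l.idxOf y)).head? = some y := by
  have h := List.idxOf_lt_length_iff.2 hy
  rw [List.head?_rotate h, List.getElem?_eq_getElem h, List.getElem_idxOf]

theorem toFinset_rotate (l : List α) (n : ℕ) :
    (l.rotate n).toFinset = l.toFinset := by
  ext v
  simp

theorem RotInvariant.cycleSum_eq (h : RotInvariant R lam) {S : Finset α} {x y : α}
    (hx : x ∈ S) (hy : y ∈ S) : cycleSum R lam S x = cycleSum R lam S y := by
  have key : ∀ {x y : α}, y ∈ S → ∀ l ∈ (nodupLists S).filter (fun l => l.toFinset = S ∧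
      l.head? = some x), l.rotate (l.idxOf y) ∈ (nodupLists S).filter (fun l => l.toFinset = S ∧
      l.head? = some y) := by
    intro x y hy l hl
    simp only [Finset.mem_filter, mem_nodupLists] at hl ⊢
    refine ⟨⟨List.nodup_rotate.2 hl.1.1, by simpa using hl.1.2⟩, ?_, ?_⟩
    · rw [toFinset_rotate]
      exact hl.2.1
    · refine head?_rotate_idxOf ?_
      rw [← List.mem_toFinset, hl.2.1]
      exact hy
  have key' : ∀ {x y : α}, x ∈ S → y ∈ S → ∀ l ∈ (nodupLists S).filter (fun l => l.toFinset = S ∧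
      l.head? = some x), (l.rotate (l.idxOf y)).rotate ((l.rotate (l.idxOf y)).idxOf x) = l := by
    intro x y hx hy l hl
    have h1 := key (y := x) hx _ (key hy l hl)
    simp only [Finset.mem_filter, mem_nodupLists] at hl h1
    rw [List.rotate_rotate] at h1 ⊢
    exact rotate_eq_self_of_head? hl.1.1 (h1.2.2.trans hl.2.2.symm)
  refine Finset.sum_bij' (fun l _ => l.rotate (l.idxOf y)) (fun l _ => l.rotate (l.idxOf x))
    (key hy) (key hx) (key' hx hy) (key' hy hx) ?_
  intro l hl
  rw [h.cycleWt_rotate]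
  simp only [Finset.mem_filter, mem_nodupLists] at hl
  exact hl.1.1

open PowerSeries

variable (R lam) in
/-- The weight of a vertex set: its polygons rooted at any fixed vertex. -/
def cycleGas (S : Finset α) : PowerSeries ℝ :=
  if h : S.Nonempty then C (cycleSum R lam S h.choose) * X ^ S.card else 0

theorem RotInvariant.cycleGas_eq (h : RotInvariant R lam) {S : Finset α} {x : α} (hx : x ∈ S) :
    cycleGas R lam S = C (cycleSum R lam S x) * X ^ S.card := by
  have hS : S.Nonempty := ⟨x, hx⟩
  rw [cycleGas, dif_pos hS, h.cycleSum_eq hS.choose_spec hx]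

/-- The derivation multiplying the `n`-th coefficient by `n`. -/
def eulerDer : Derivation ℝ (PowerSeries ℝ) (PowerSeries ℝ) := (X : PowerSeries ℝ) • derivative ℝ

theorem coeff_eulerDer (p : PowerSeries ℝ) (n : ℕ) : coeff n (eulerDer p) = n * coeff n p := by
  have : eulerDer p = X * derivative ℝ p := rfl
  rw [this]
  cases n with
  | zero => simp
  | succ n =>
    rw [coeff_succ_X_mul, coeff_derivative]
    push_cast
    ring

theorem eulerDer_cycleGas (S : Finset α) :
    eulerDer (cycleGas R lam S) = S.card • cycleGas R lam S := by
  rw [cycleGas]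
  split_ifs with h
  · ext n
    rw [coeff_eulerDer, map_nsmul, nsmul_eq_mul, coeff_C_mul, coeff_X_pow]
    split_ifs with hn
    · rw [hn]
    · simp
  · simp

/-- Expansion of the partition function in the polygons rooted at a point. -/
theorem RotInvariant.gasSum_cycleGas (h : RotInvariant R lam) {D : Finset α} {x : α}
    (hx : x ∈ D) : gasSum (cycleGas R lam) (D.erase x) - gasSum (cycleGas R lam) D =
      ∑ η ∈ nodupLists (D.erase x), C (cycleWt R lam (x :: η)) * X ^ (η.length + 1) *
        gasSum (cycleGas R lam) (D.erase x \ η.toFinset) := by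
  rw [gasSum_eq _ D x, sub_sub_cancel]
  have hmaps : ∀ η ∈ nodupLists (D.erase x),
      (x :: η).toFinset ∈ D.powerset.filter (fun S => x ∈ S) := by
    intro η hη
    rw [mem_nodupLists] at hη
    simp only [Finset.mem_filter, Finset.mem_powerset]
    refine ⟨fun v hv => ?_, by simp⟩
    rcases List.mem_cons.1 (List.mem_toFinset.1 hv) with rfl | hv
    · exact hx
    · exact Finset.mem_of_mem_erase (hη.2 v hv)
  rw [← Finset.sum_fiberwise_of_maps_to hmaps]
  refine Finset.sum_congr rfl fun S hS => ?_
  simp only [Finset.mem_filter, Finset.mem_powerset] at hS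
  rw [h.cycleGas_eq hS.2, cycleSum, map_sum, Finset.sum_mul, Finset.sum_mul]
  symm
  refine Finset.sum_bij (fun η _ => x :: η) ?_ ?_ ?_ ?_
  · intro η hη
    simp only [Finset.mem_filter, mem_nodupLists] at hη ⊢
    refine ⟨⟨?_, ?_⟩, hη.2, rfl⟩
    · rw [List.nodup_cons]
      exact ⟨fun hm => by simpa using hη.1.2 x hm, hη.1.1⟩
    · intro v hv
      rw [← hη.2]
      exact List.mem_toFinset.2 hv
  · intro a _ b _ hab
    simpa using hab
  · intro l hl
    simp only [Finset.mem_filter, mem_nodupLists] at hl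
    obtain ⟨η, rfl⟩ := List.head?_eq_some_iff.1 hl.2.2
    have hn := List.nodup_cons.1 hl.1.1
    refine ⟨η, ?_, rfl⟩
    simp only [Finset.mem_filter, mem_nodupLists]
    refine ⟨⟨hn.2, fun v hv => Finset.mem_erase.2 ⟨fun hvx => hn.1 (hvx ▸ hv), ?_⟩⟩, hl.2.1⟩
    exact hS.1 (hl.1.2 v (by simp [hv]))
  · intro η hη
    simp only [Finset.mem_filter, mem_nodupLists] at hη
    have hn : (x :: η).Nodup := by
      rw [List.nodup_cons]
      exact ⟨fun hm => by simpa using hη.1.2 x hm, hη.1.1⟩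
    have h1 : S.card = η.length + 1 := by
      rw [← hη.2, List.toFinset_card_of_nodup hn, List.length_cons]
    have h2 : D.erase x \ η.toFinset = D \ S := by
      rw [← hη.2]
      ext v
      simp only [Finset.mem_sdiff, Finset.mem_erase, List.toFinset_cons, Finset.mem_insert]
      tauto
    rw [h1, h2]

end CycleWeights

section LoopDeterminant

open PowerSeries

variable {α : Type*} [DecidableEq α] {R : α → α → Prop} {lam : List α → ℝ≥0}

variable (R lam) in
/-- The closed walk series in `D` are the quotients of the partition functions. -/
def LoopQuotient (D : Finset α) : Prop :=
  gasSum (cycleGas R lam) D ≠ 0 ∧ ∀ x ∈ D, loopSeries R lam D x ∈ finiteSeries ∧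
    toRealSeries (loopSeries R lam D x) * gasSum (cycleGas R lam) D =
      gasSum (cycleGas R lam) (D.erase x)

theorem loopProd_quotient {D : Finset α} (hD : ∀ E ⊆ D, LoopQuotient R lam E) {η : List α}
    (hη : η ∈ nodupLists D) : loopProd R lam D η ∈ finiteSeries ∧
      toRealSeries (loopProd R lam D η) * gasSum (cycleGas R lam) D =
        gasSum (cycleGas R lam) (D \ η.toFinset) := by
  induction η generalizing D with
  | nil => simp [loopProd, one_mem]
  | cons x η ih =>
    rw [mem_nodupLists, List.nodup_cons] at hη
    have hη' : η ∈ nodupLists (D.erase x) := mem_nodupLists.2 ⟨hη.1.2, fun v hv =>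
      Finset.mem_erase.2 ⟨fun h => hη.1.1 (h ▸ hv), hη.2 v (by simp [hv])⟩⟩
    obtain ⟨h1, h2⟩ := ih (fun E hE => hD E (hE.trans (Finset.erase_subset _ _))) hη'
    obtain ⟨h3, h4⟩ := (hD D subset_rfl).2 x (hη.2 x (by simp))
    have h5 : D \ (x :: η).toFinset = D.erase x \ η.toFinset := by
      ext v
      simp only [Finset.mem_sdiff, Finset.mem_erase, List.toFinset_cons, Finset.mem_insert]
      tauto
    rw [loopProd, toRealSeries_mul h3 h1, h5, ← h2, ← h4]
    exact ⟨mul_mem h3 h1, by ring⟩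

theorem returnSeries_eq_loopProd (D : Finset α) (x : α) :
    returnSeries R lam D x = ∑ η ∈ nodupLists (D.erase x),
      C ((if (x :: (η ++ [x])).IsChain R then lam (x :: (η ++ [x])) else 0 : ℝ≥0) : ℝ≥0∞) *
        X ^ (η.length + 1) * loopProd R lam (D.erase x) η := by
  rw [returnSeries_eq]
  refine Finset.sum_congr rfl fun η hη => ?_
  rw [mem_nodupLists] at hη
  split_ifs with hc
  · rw [pathSeries_eq (List.isChain_append.1 (List.isChain_cons.1 hc).2).1 hη.1 hη.2, pow_succ]
    ring
  · simp

theorem RotInvariant.loopQuotient (h : RotInvariant R lam) (D : Finset α) :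
    LoopQuotient R lam D := by
  induction D using Finset.strongInduction with
  | H D ih =>
    have key : ∀ x ∈ D, loopSeries R lam D x ∈ finiteSeries ∧
        toRealSeries (loopSeries R lam D x) * gasSum (cycleGas R lam) D =
          gasSum (cycleGas R lam) (D.erase x) := by
      intro x hx
      have hP : ∀ η ∈ nodupLists (D.erase x), _ := fun η hη => loopProd_quotient
        (fun E hE => ih E (hE.trans_ssubset (Finset.erase_ssubset hx))) hη
      have hterm : ∀ η ∈ nodupLists (D.erase x),
          C ((if (x :: (η ++ [x])).IsChain R then lam (x :: (η ++ [x])) else 0 : ℝ≥0) : ℝ≥0∞) *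
            X ^ (η.length + 1) * loopProd R lam (D.erase x) η ∈ finiteSeries := fun η hη =>
        mul_mem (mul_mem (C_mem_finiteSeries _) (X_pow_mem_finiteSeries _)) (hP η hη).1
      have hF : returnSeries R lam D x ∈ finiteSeries := by
        rw [returnSeries_eq_loopProd]
        exact sum_mem hterm
      have h0 : coeff 0 (returnSeries R lam D x) = 0 := by
        rw [returnSeries, coeff_gf]
        simp
      have hB := loopSeries_eq (R := R) (lam := lam) hx
      have hfin := renewal_mem_finiteSeries hF h0 hB
      refine ⟨hfin, ?_⟩
      have hBr : toRealSeries (loopSeries R lam D x) =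
          1 + toRealSeries (returnSeries R lam D x) * toRealSeries (loopSeries R lam D x) := by
        conv_lhs => rw [hB]
        rw [toRealSeries_add (one_mem _) (mul_mem hF hfin), toRealSeries_mul hF hfin,
          toRealSeries_one]
      have hFr : toRealSeries (returnSeries R lam D x) * gasSum (cycleGas R lam) (D.erase x) =
          gasSum (cycleGas R lam) (D.erase x) - gasSum (cycleGas R lam) D := by
        rw [h.gasSum_cycleGas hx, returnSeries_eq_loopProd, toRealSeries_sum hterm, Finset.sum_mul]
        refine Finset.sum_congr rfl fun η hη => ?_
        rw [toRealSeries_mul (mul_mem (C_mem_finiteSeries _) (X_pow_mem_finiteSeries _))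
          (hP η hη).1, toRealSeries_mul (C_mem_finiteSeries _) (X_pow_mem_finiteSeries _),
          toRealSeries_C, toRealSeries_X_pow, mul_assoc, (hP η hη).2, cycleWt]
        simp only [List.take_succ_cons, List.take_zero, List.cons_append]
        by_cases hc : (x :: (η ++ [x])).IsChain R <;> simp [hc]
      linear_combination toRealSeries (loopSeries R lam D x) * hFr +
        gasSum (cycleGas R lam) (D.erase x) * hBr
    refine ⟨?_, key⟩
    rcases D.eq_empty_or_nonempty with rfl | ⟨x, hx⟩
    · rw [gasSum_empty]
      exact one_ne_zero
    · intro h0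
      have := (key x hx).2
      rw [h0, mul_zero] at this
      exact (ih _ (Finset.erase_ssubset hx)).1 this.symm

/-- Closed walks may be inserted at the start or at the end of a self-avoiding path. -/
theorem RotInvariant.loopSeries_mul_loopProd (h : RotInvariant R lam) {D : Finset α} {x : α}
    {η : List α} (hx : x ∈ D) (hη : η ∈ nodupLists (D.erase x)) :
    loopSeries R lam D x * loopProd R lam (D.erase x) η =
      loopProd R lam D η * loopSeries R lam (D \ η.toFinset) x := by
  have hη' := mem_nodupLists.1 hη
  have hxη : x ∉ η := fun hm => by simpa using hη'.2 x hm
  have hηD : η ∈ nodupLists D :=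
    mem_nodupLists.2 ⟨hη'.1, fun v hv => Finset.mem_of_mem_erase (hη'.2 v hv)⟩
  obtain ⟨a1, a2⟩ := (h.loopQuotient D).2 x hx
  obtain ⟨b1, b2⟩ := loopProd_quotient (fun E _ => h.loopQuotient E) hη
  obtain ⟨c1, c2⟩ := loopProd_quotient (fun E _ => h.loopQuotient E) hηD
  obtain ⟨d1, d2⟩ := (h.loopQuotient (D \ η.toFinset)).2 x (by simp [hx, hxη])
  refine toRealSeries_inj (mul_mem a1 b1) (mul_mem c1 d1) ?_
  rw [toRealSeries_mul a1 b1, toRealSeries_mul c1 d1]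
  refine mul_right_cancel₀ (h.loopQuotient D).1 ?_
  have he : (D \ η.toFinset).erase x = D.erase x \ η.toFinset := by
    ext v
    simp only [Finset.mem_sdiff, Finset.mem_erase]
    tauto
  rw [he] at d2
  linear_combination toRealSeries (loopProd R lam (D.erase x) η) * a2 + b2 - d2 -
    toRealSeries (loopSeries R lam (D \ η.toFinset) x) * c2

end LoopDeterminant

section Gronwall

open PowerSeries

/-- A power series solving `t b' = m b` with nonnegative coefficients is bounded by the
exponential of the primitive of `m / t`. -/
theorem sum_le_exp_of_euler {b m : ℕ → ℝ} (hb : ∀ n, 0 ≤ b n) (hm : ∀ n, 0 ≤ m n) (hb0 : b 0 = 1)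
    (hm0 : m 0 = 0) (h : ∀ n, n * b n = ∑ p ∈ Finset.HasAntidiagonal.antidiagonal n, b p.1 * m p.2) {t : ℝ}
    (ht : 0 ≤ t) (N : ℕ) : ∑ n ∈ Finset.range N, b n * t ^ n ≤
      Real.exp (∑ n ∈ Finset.range N, m n / n * t ^ n) := by
  rcases Nat.eq_zero_or_pos N with rfl | hN
  · simp
  have hder : ∀ (c : ℕ → ℝ) (s : ℝ), HasDerivAt (fun s => ∑ n ∈ Finset.range N, c n * s ^ n)
      (∑ n ∈ Finset.range N, c n * (n * s ^ (n - 1))) s := fun c s =>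
    HasDerivAt.fun_sum fun n _ => (hasDerivAt_pow n s).const_mul (c n)
  have hX : ∀ (c : ℕ → ℝ) (s : ℝ), s * ∑ n ∈ Finset.range N, c n * (n * s ^ (n - 1)) =
      ∑ n ∈ Finset.range N, n * c n * s ^ n := by
    intro c s
    rw [Finset.mul_sum]
    refine Finset.sum_congr rfl fun n _ => ?_
    cases n with
    | zero => simp
    | succ n =>
      rw [Nat.add_sub_cancel, pow_succ]
      ring
  have hg : ∀ s : ℝ, HasDerivAt (fun s => (∑ n ∈ Finset.range N, b n * s ^ n) *
      Real.exp (-∑ n ∈ Finset.range N, m n / n * s ^ n)) _ s := fun s =>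
    (hder b s).mul (hder (fun n => m n / n) s).fun_neg.exp
  have hanti : AntitoneOn (fun s : ℝ => (∑ n ∈ Finset.range N, b n * s ^ n) *
      Real.exp (-∑ n ∈ Finset.range N, m n / n * s ^ n)) (Set.Ici 0) := by
    refine antitoneOn_of_deriv_nonpos (convex_Ici 0)
      (fun s _ => (hg s).continuousAt.continuousWithinAt)
      (fun s _ => (hg s).differentiableAt.differentiableWithinAt) ?_
    intro s hs
    rw [interior_Ici, Set.mem_Ioi] at hs
    rw [(hg s).deriv]
    have key : s * ∑ n ∈ Finset.range N, b n * (n * s ^ (n - 1)) ≤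
        (∑ n ∈ Finset.range N, b n * s ^ n) *
          (s * ∑ n ∈ Finset.range N, m n / n * (n * s ^ (n - 1))) := by
      rw [hX, hX]
      have h1 : ∀ n ∈ Finset.range N, n * (m n / n) * s ^ n = m n * s ^ n := by
        intro n _
        rcases Nat.eq_zero_or_pos n with rfl | hn
        · simp [hm0]
        · field_simp
      rw [Finset.sum_congr rfl h1, Finset.sum_mul_sum, ← Finset.sum_product']
      calc ∑ n ∈ Finset.range N, n * b n * s ^ n
          = ∑ n ∈ Finset.range N, ∑ p ∈ Finset.HasAntidiagonal.antidiagonal n,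
              b p.1 * s ^ p.1 * (m p.2 * s ^ p.2) := by
            refine Finset.sum_congr rfl fun n _ => ?_
            rw [h, Finset.sum_mul]
            refine Finset.sum_congr rfl fun p hp => ?_
            rw [← Finset.HasAntidiagonal.mem_antidiagonal.1 hp, pow_add]
            ring
        _ = ∑ q ∈ (Finset.range N).sigma Finset.HasAntidiagonal.antidiagonal,
              b q.2.1 * s ^ q.2.1 * (m q.2.2 * s ^ q.2.2) := by rw [Finset.sum_sigma']
        _ = ∑ p ∈ ((Finset.range N).sigma Finset.HasAntidiagonal.antidiagonal).image (fun q => q.2),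
              b p.1 * s ^ p.1 * (m p.2 * s ^ p.2) := by
            rw [Finset.sum_image]
            rintro ⟨n, p⟩ hp ⟨n', p'⟩ hp' hpp
            simp only [Finset.coe_sigma, Set.mem_sigma_iff, Finset.mem_coe,
              Finset.HasAntidiagonal.mem_antidiagonal] at hp hp' hpp
            subst hpp
            rw [← hp.2, ← hp'.2]
        _ ≤ _ := by
            refine Finset.sum_le_sum_of_subset_of_nonneg ?_ fun p _ _ => ?_
            · intro p hp
              simp only [Finset.mem_image, Finset.mem_sigma, Finset.mem_range,
                Finset.HasAntidiagonal.mem_antidiagonal] at hp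
              obtain ⟨q, ⟨h1, h2⟩, rfl⟩ := hp
              simp only [Finset.mem_product, Finset.mem_range]
              omega
            · have := hb p.1
              have := hm p.2
              positivity
    have he := Real.exp_pos (-∑ n ∈ Finset.range N, m n / n * s ^ n)
    have h2 : ∑ n ∈ Finset.range N, b n * (n * s ^ (n - 1)) ≤
        (∑ n ∈ Finset.range N, b n * s ^ n) *
          ∑ n ∈ Finset.range N, m n / n * (n * s ^ (n - 1)) := by
      refine le_of_mul_le_mul_left ?_ hs
      linarith
    linarith [mul_le_mul_of_nonneg_right h2 he.le]
  have h0 := hanti (Set.mem_Ici.2 le_rfl) (Set.mem_Ici.2 ht) ht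
  have hz : ∀ c : ℕ → ℝ, ∑ n ∈ Finset.range N, c n * (0 : ℝ) ^ n = c 0 := by
    intro c
    rw [Finset.sum_eq_single_of_mem 0 (Finset.mem_range.2 hN)]
    · simp
    · intro n _ hn
      simp [hn]
  simp only [hz, hb0, hm0, zero_div, neg_zero, Real.exp_zero, mul_one, Real.exp_neg] at h0
  rwa [← div_eq_mul_inv, div_le_one (Real.exp_pos _)] at h0

/-- The bound of `sum_le_exp_of_euler` for the evaluations in `[0, ∞]`. -/
theorem ev_le_eexp {b m : PowerSeries ℝ≥0∞} (hb : b ∈ finiteSeries)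
    (hb0 : coeff 0 b = 1) (hm0 : coeff 0 m = 0)
    (h : eulerDer (toRealSeries b) = toRealSeries b * toRealSeries m) (z : ℝ≥0) :
    ev z b ≤ eexp (∑' n : ℕ, coeff n m * (z ^ n / n)) := by
  rw [eexp]
  split_ifs with hS
  · exact le_top
  refine ENNReal.tsum_le_of_sum_range_le fun N => ?_
  have hfin : ∀ n ∈ Finset.range N, coeff n b * (z : ℝ≥0∞) ^ n ≠ ⊤ := fun n _ =>
    ENNReal.mul_ne_top (mem_finiteSeries.1 hb n) (by simp)
  rw [ENNReal.le_ofReal_iff_toReal_le (ENNReal.sum_ne_top.2 hfin) (Real.exp_pos _).le,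
    ENNReal.toReal_sum hfin]
  have key := sum_le_exp_of_euler (b := fun n => (coeff n b).toReal)
    (m := fun n => (coeff n m).toReal) (fun _ => ENNReal.toReal_nonneg)
    (fun _ => ENNReal.toReal_nonneg) (by simp [hb0]) (by simp [hm0]) (by
      intro n
      have := congrArg (coeff n) h
      rw [coeff_eulerDer, coeff_mul] at this
      simpa using this) z.coe_nonneg N
  refine (le_of_eq ?_).trans (key.trans (Real.exp_le_exp.2 ?_))
  · simp
  · have hsum := ENNReal.sum_le_tsum (f := fun n : ℕ => coeff n m * ((z : ℝ≥0∞) ^ n / n))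
      (Finset.range N)
    have hne := ne_top_of_le_ne_top hS hsum
    refine (le_of_eq ?_).trans (ENNReal.toReal_mono hS hsum)
    rw [ENNReal.toReal_sum (ENNReal.sum_ne_top.1 hne)]
    refine Finset.sum_congr rfl fun n _ => ?_
    simp only [ENNReal.toReal_mul, ENNReal.toReal_div, ENNReal.toReal_pow, ENNReal.coe_toReal,
      ENNReal.toReal_natCast]
    ring

end Gronwall

section LoopExponential

open PowerSeries

variable {α : Type*} [DecidableEq α] {R : α → α → Prop} {lam : List α → ℝ≥0}

variable (R lam) in
/-- Generating function of the closed walks in `D` at `v` which visit `o`. -/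
def hitSeries (D : Finset α) (o v : α) : PowerSeries ℝ≥0∞ :=
  gf List.length fun p =>
    if ((∀ u ∈ p, u ∈ D) ∧ ClosedTail v p) ∧ o ∈ p then walkWt R lam (v :: p) else 0

theorem loopSeries_eq_erase_add (D : Finset α) (o v : α) :
    loopSeries R lam D v = loopSeries R lam (D.erase o) v + hitSeries R lam D o v := by
  rw [loopSeries, loopSeries, hitSeries, ← gf_add]
  congr 1
  ext p
  have h1 : (∀ u ∈ p, u ∈ D.erase o) ↔ (∀ u ∈ p, u ∈ D) ∧ o ∉ p := by
    simp only [Finset.mem_erase]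
    exact ⟨fun h => ⟨fun u hu => (h u hu).2, fun ho => (h o ho).1 rfl⟩,
      fun h u hu => ⟨fun huo => h.2 (huo ▸ hu), h.1 u hu⟩⟩
  simp only [h1]
  by_cases ho : o ∈ p <;> simp [ho]

theorem loopSeries_of_notMem {D : Finset α} {v : α} (hv : v ∉ D) : loopSeries R lam D v = 1 := by
  ext n
  rw [loopSeries, coeff_gf, tsum_eq_single []]
  · simp [coeff_one, ClosedTail, @eq_comm ℕ 0 n]
  · intro p hp
    rw [if_neg (c := _ ∧ ClosedTail v p), ite_self]
    rintro ⟨h1, h2 | ⟨q, rfl⟩⟩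
    · exact hp h2
    · exact hv (h1 v (by simp))

theorem coeff_zero_hitSeries (D : Finset α) (o v : α) :
    coeff 0 (hitSeries R lam D o v) = 0 := by
  rw [hitSeries, coeff_gf, ENNReal.tsum_eq_zero]
  intro p
  split_ifs with h1 h2
  · rw [List.length_eq_zero_iff.1 h1] at h2
    simp at h2
  · rfl
  · rfl

theorem coeff_zero_loopSeries (D : Finset α) (v : α) : coeff 0 (loopSeries R lam D v) = 1 := by
  rw [loopSeries, coeff_gf, tsum_eq_single []]
  · simp [ClosedTail]
  · intro p hp
    rw [if_neg (by simpa using hp)]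

theorem RotInvariant.hitSeries_mem_finiteSeries (h : RotInvariant R lam) {D : Finset α} (o : α)
    {v : α} (hv : v ∈ D) : hitSeries R lam D o v ∈ finiteSeries := by
  have hf := mem_finiteSeries.1 ((h.loopQuotient D).2 v hv).1
  rw [mem_finiteSeries]
  intro n hn
  refine hf n ?_
  rw [loopSeries_eq_erase_add D o v, map_add, hn, add_top]

/-- The logarithmic derivative of the closed walk series is the loop series. -/
theorem RotInvariant.eulerDer_loopSeries (h : RotInvariant R lam) {D : Finset α} {o : α}
    (ho : o ∈ D) : eulerDer (toRealSeries (loopSeries R lam D o)) =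
      toRealSeries (loopSeries R lam D o) * toRealSeries (∑ v ∈ D, hitSeries R lam D o v) := by
  have hQ := h.loopQuotient D
  set Δ := gasSum (cycleGas R lam) D with hΔ
  set Δ' := gasSum (cycleGas R lam) (D.erase o) with hΔ'
  set b := toRealSeries (loopSeries R lam D o) with hb
  have hbΔ : b * Δ = Δ' := (hQ.2 o ho).2
  have h1 : eulerDer Δ = ∑ v ∈ D, (1 - toRealSeries (loopSeries R lam D v)) * Δ := by
    rw [hΔ, derivation_gasSum _ _ eulerDer_cycleGas]
    refine Finset.sum_congr rfl fun v hv => ?_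
    rw [← (hQ.2 v hv).2]
    ring
  have h2 : eulerDer Δ' =
      ∑ v ∈ D, (1 - toRealSeries (loopSeries R lam (D.erase o) v)) * Δ' := by
    rw [hΔ', derivation_gasSum _ _ eulerDer_cycleGas, ← Finset.add_sum_erase _ _ ho,
      loopSeries_of_notMem (Finset.notMem_erase o D), toRealSeries_one, sub_self, zero_mul,
      zero_add]
    refine Finset.sum_congr rfl fun v hv => ?_
    rw [← ((h.loopQuotient (D.erase o)).2 v hv).2]
    ring
  have h3 : b * eulerDer Δ + Δ * eulerDer b = eulerDer Δ' := by
    rw [← hbΔ, Derivation.leibniz]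
    rfl
  refine mul_right_cancel₀ hQ.1 ?_
  rw [toRealSeries_sum fun v hv => h.hitSeries_mem_finiteSeries o hv]
  have h4 : ∀ v ∈ D, toRealSeries (hitSeries R lam D o v) =
      toRealSeries (loopSeries R lam D v) - toRealSeries (loopSeries R lam (D.erase o) v) := by
    intro v hv
    rw [loopSeries_eq_erase_add D o v, toRealSeries_add _ (h.hitSeries_mem_finiteSeries o hv),
      add_sub_cancel_left]
    by_cases hvo : v = o
    · subst hvo
      rw [loopSeries_of_notMem (Finset.notMem_erase v D)]
      exact one_mem _
    · exact ((h.loopQuotient (D.erase o)).2 v (Finset.mem_erase.2 ⟨hvo, hv⟩)).1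
  rw [Finset.sum_congr rfl h4]
  have h5 : b * (∑ v ∈ D, (toRealSeries (loopSeries R lam D v) -
      toRealSeries (loopSeries R lam (D.erase o) v))) * Δ = eulerDer Δ' - b * eulerDer Δ := by
    rw [h1, h2, ← hbΔ, ← Finset.sum_mul, ← Finset.sum_mul, Finset.sum_sub_distrib,
      Finset.sum_sub_distrib, Finset.sum_sub_distrib]
    ring
  rw [h5, ← h3]
  ring

/-- Exponential bound of the closed walks at `o` by the loops through `o`. -/
theorem RotInvariant.ev_loopSeries_le (h : RotInvariant R lam) {D : Finset α} {o : α}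
    (ho : o ∈ D) (z : ℝ≥0) : ev z (loopSeries R lam D o) ≤
      eexp (∑ v ∈ D, ∑' p : List α, if ((∀ u ∈ p, u ∈ D) ∧ ClosedTail v p) ∧ o ∈ p then
        walkWt R lam (v :: p) * (z ^ p.length / p.length) else 0) := by
  refine (ev_le_eexp ((h.loopQuotient D).2 o ho).1
    (coeff_zero_loopSeries D o) (by simp [coeff_zero_hitSeries]) (h.eulerDer_loopSeries ho) z).trans (le_of_eq ?_)
  simp only [map_sum, Finset.sum_mul]
  rw [Summable.tsum_finsetSum fun _ _ => ENNReal.summable]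
  refine congrArg eexp (Finset.sum_congr rfl fun v _ => ?_)
  rw [hitSeries, tsum_coeff_gf_mul]
  refine tsum_congr fun p => ?_
  split_ifs <;> simp

end LoopExponential

section PathBound

open PowerSeries

variable {α : Type*} [DecidableEq α] {R : α → α → Prop} {lam : List α → ℝ≥0}

theorem gf_getLast_eq (D : Finset α) (o y : α) :
    (gf List.length fun p => if (∀ v ∈ p, v ∈ D) ∧ (o :: p).getLast? = some y then
      walkWt R lam (o :: p) else 0) =
    ∑ η ∈ (nodupLists (D.erase o)).filter
        (fun η => (o :: η).IsChain R ∧ (o :: η).getLast? = some y),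
      loopSeries R lam D o * pathSeries R lam (D.erase o) η := by
  rw [Finset.sum_congr rfl fun η hη => (gf_tail_eq (D := D) (lam := lam)
    (Finset.mem_filter.1 hη).2.1).symm, ← gf_sum]
  congr 1
  ext p
  by_cases hw : walkWt R lam (o :: p) = 0
  · simp [hw]
  have hc := isChain_of_walkWt_ne_zero hw
  obtain ⟨h1, h2, h3, h4, h5⟩ := LE_invariant hc
  obtain ⟨η, hη⟩ := List.head?_eq_some_iff.1 h4
  rw [hη] at h1 h2 h3 h5
  by_cases hD : ∀ v ∈ p, v ∈ D
  · have hmem : η ∈ nodupLists (D.erase o) := by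
      rw [List.nodup_cons] at h1
      refine mem_nodupLists.2 ⟨h1.2, fun v hv => ?_⟩
      have hvo : v ≠ o := fun h => h1.1 (h ▸ hv)
      refine Finset.mem_erase.2 ⟨hvo, hD v ?_⟩
      simpa [hvo] using h2 (List.mem_cons_of_mem o hv)
    simp only [hη, List.cons.injEq, true_and]
    by_cases hl : (o :: p).getLast? = some y
    · rw [if_pos ⟨hD, hl⟩, Finset.sum_eq_single η]
      · rw [if_pos ⟨hD, rfl⟩]
      · intro η' _ hne
        rw [if_neg fun h => hne h.2.symm]
      · intro hn
        exact absurd (Finset.mem_filter.2 ⟨hmem, h3, h5.trans hl⟩) hn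
    · rw [if_neg fun h => hl h.2]
      refine (Finset.sum_eq_zero fun η' hη' => if_neg ?_).symm
      rintro ⟨-, rfl⟩
      exact hl (h5.symm.trans (Finset.mem_filter.1 hη').2.2)
  · rw [if_neg fun h => hD h.1]
    exact (Finset.sum_eq_zero fun η' _ => if_neg fun h => hD h.1).symm

theorem sum_ev_pathSeries_le (D : Finset α) (o y : α) (z : ℝ≥0) {s : Finset (List α)}
    (hs : ∀ η ∈ s, (∃ u ∈ η.head?, R o u) ∧ η.getLast? = some y) :
    ∑ η ∈ s, ev z (pathSeries R lam D η) ≤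
      ∑' q : List α, (if (∃ u ∈ q.head?, R o u) ∧ q.getLast? = some y then
        walkWt R lam q else 0) * (z : ℝ≥0∞) ^ q.length := by
  simp only [pathSeries, ev_gf]
  rw [← Summable.tsum_finsetSum fun _ _ => ENNReal.summable]
  refine ENNReal.tsum_le_tsum fun q => ?_
  rw [← Finset.sum_mul]
  gcongr
  by_cases hw : walkWt R lam q = 0
  · simp [hw]
  obtain ⟨-, -, -, h4, h5⟩ := LE_invariant (isChain_of_walkWt_ne_zero hw)
  by_cases hq : LE q ∈ s
  · have hs' := hs _ hq
    rw [h4, h5] at hs'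
    rw [Finset.sum_eq_single_of_mem _ hq, if_pos hs']
    · split_ifs <;> simp
    · intro η _ hne
      rw [if_neg fun h : _ ∧ LE q = η => hne h.2.symm]
  · rw [Finset.sum_eq_zero]
    · exact zero_le
    · intro η hη
      rw [if_neg fun h : _ ∧ LE q = η => hq (h.2 ▸ hη)]

/-- One-step bound in a finite domain. -/
theorem RotInvariant.tsum_path_le_of_mem (h : RotInvariant R lam) {D : Finset α} {o y : α}
    (ho : o ∈ D) (hy : y ≠ o) {z : ℝ≥0} {K : ℝ≥0∞} (hK : ∀ (E : Finset α) (u : α), o ∈ E → u ∉ E →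
      R o u → ev z (loopSeries R lam E o) ≤ K) :
    ∑' p : List α, (if (∀ v ∈ p, v ∈ D) ∧ (o :: p).getLast? = some y then
      walkWt R lam (o :: p) else 0) * (z : ℝ≥0∞) ^ p.length ≤
    (∑' q : List α, (if (∃ u ∈ q.head?, R o u) ∧ q.getLast? = some y then
        walkWt R lam q else 0) * (z : ℝ≥0∞) ^ q.length) * K := by
  have hcons : ∀ η ∈ (nodupLists (D.erase o)).filter
      (fun η => (o :: η).IsChain R ∧ (o :: η).getLast? = some y),
      (∃ u ∈ η.head?, R o u) ∧ η.getLast? = some y := by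
    intro η hη
    rw [Finset.mem_filter] at hη
    obtain ⟨-, hc, hl⟩ := hη
    cases η with
    | nil => simp [hy.symm] at hl
    | cons u η =>
      rw [List.getLast?_cons_cons] at hl
      exact ⟨⟨u, rfl, (List.isChain_cons_cons.1 hc).1⟩, hl⟩
  rw [← ev_gf, gf_getLast_eq, ev_sum]
  refine le_trans ?_ (mul_le_mul_left (sum_ev_pathSeries_le D o y z hcons) K)
  rw [Finset.sum_mul]
  refine Finset.sum_le_sum fun η hη => ?_
  obtain ⟨u, hu, hou⟩ := (hcons η hη).1
  rw [Finset.mem_filter] at hη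
  have hη1 := mem_nodupLists.1 hη.1
  have hc := (List.isChain_cons.1 hη.2.1).2
  have huη : u ∈ η := List.mem_of_mem_head? hu
  have hoη : o ∉ η := fun hm => by simpa using hη1.2 o hm
  rw [pathSeries_eq hc hη1.1 hη1.2, pathSeries_eq hc hη1.1
    fun v hv => Finset.mem_of_mem_erase (hη1.2 v hv), mul_left_comm,
    h.loopSeries_mul_loopProd ho hη.1, ← mul_assoc, ev_mul]
  gcongr
  exact hK _ u (by simp [ho, hoη]) (by simp [huη]) hou

/-- One-step bound for walks with loop activities. -/
theorem RotInvariant.tsum_path_le (h : RotInvariant R lam) {o y : α}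
    (hy : y ≠ o) {z : ℝ≥0} {K : ℝ≥0∞} (hK : ∀ (E : Finset α) (u : α), o ∈ E → u ∉ E →
      R o u → ev z (loopSeries R lam E o) ≤ K) :
    ∑' p : List α, (if (o :: p).getLast? = some y then walkWt R lam (o :: p) else 0) *
      (z : ℝ≥0∞) ^ p.length ≤
    (∑' q : List α, (if (∃ u ∈ q.head?, R o u) ∧ q.getLast? = some y then
        walkWt R lam q else 0) * (z : ℝ≥0∞) ^ q.length) * K := by
  rw [ENNReal.tsum_eq_iSup_sum]
  refine iSup_le fun s => ?_
  set D := insert o (s.biUnion List.toFinset) with hD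
  refine le_trans ?_ (h.tsum_path_le_of_mem (Finset.mem_insert_self o _ : o ∈ D) hy hK)
  refine le_trans (Finset.sum_le_sum fun p hp => ?_) (ENNReal.sum_le_tsum s)
  have : ∀ v ∈ p, v ∈ D := fun v hv => by
    rw [hD, Finset.mem_insert, Finset.mem_biUnion]
    exact Or.inr ⟨p, hp, List.mem_toFinset.2 hv⟩
  exact le_of_eq (congrArg (· * (z : ℝ≥0∞) ^ p.length)
    (if_congr (and_iff_right this).symm rfl rfl))

end PathBound

section Lattice

variable {d : ℕ} {lam : List (Pt d) → ℝ≥0}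

theorem dist1_self (x : Pt d) : dist1 x x = 0 := by simp [dist1]

theorem isSAPList_close {x : Pt d} {s : List (Pt d)} (hnd : (x :: s).Nodup)
    (hc : (x :: s ++ [x]).IsChain Adj) : IsSAPList (x :: s ++ [x]) := by
  refine ⟨hc, ?_, by rw [List.getLastD_concat]; rfl, ?_⟩
  · cases s with
    | nil =>
      have : Adj x x := by simpa using hc
      rw [Adj, dist1_self] at this
      omega
    | cons y s => simp
  · rwa [List.dropLast_concat]

theorem SymmAssumption.rotInvariant (h : SymmAssumption lam) : RotInvariant Adj lam := by
  intro l hl hc r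
  cases l with
  | nil => simp
  | cons x s =>
    have h1 := h.2.1 _ (isSAPList_close hl hc) r
    rw [polyRot, List.dropLast_concat] at h1
    refine Eq.trans (congrArg lam (congrArg _ ?_)) h1
    obtain ⟨y, t, ht⟩ : ∃ y t, (x :: s).rotate r = y :: t :=
      List.exists_cons_of_ne_nil (by simp [List.rotate_eq_nil_iff])
    simp [ht]

theorem isSAPList_of_mem_erasedLoops {l c : List (Pt d)} (hl : l.IsChain Adj)
    (hc : c ∈ erasedLoops l) : IsSAPList c := by
  rw [erasedLoops_eq] at hc
  obtain ⟨x, s, rfl, h1, h2⟩ := erasedLoop_spec (R := Adj) List.nodup_nil hl hc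
  exact isSAPList_close h1 h2

theorem SymmAssumption.loopWt_map (h : SymmAssumption lam) {R : Pt d ≃ Pt d} (hR : IsLatticeIso R)
    {l : List (Pt d)} (hl : l.IsChain Adj) : loopWt lam (l.map R) = loopWt lam l := by
  rw [loopWt, loopWt, erasedLoops_map R.injective, Multiset.map_map]
  refine congrArg Multiset.prod (Multiset.map_congr rfl fun c hc => ?_)
  rw [Function.comp_apply, h.1 R hR c (isSAPList_of_mem_erasedLoops hl hc)]

/-- The image of a walk under a lattice isometry. -/
def Walk.map (R : Pt d ≃ Pt d) (hR : IsLatticeIso R) (ω : Walk d) : Walk d where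
  pts := ω.pts.map R
  ne := by simpa using ω.ne
  chain := List.isChain_map_of_isChain R (fun x y hxy => by rw [Adj, hR]; exact hxy) ω.chain

theorem Walk.ext {ω ω' : Walk d} (h : ω.pts = ω'.pts) : ω = ω' := by
  cases ω
  cases ω'
  simpa using h

theorem mu_le_of_iso (h : SymmAssumption lam) (z : ℝ≥0) {R : Pt d ≃ Pt d} (hR : IsLatticeIso R)
    (A B : Set (Pt d)) : mu lam z A B ≤ mu lam z (R '' A) (R '' B) := by
  have hinj : Function.Injective (Walk.map R hR) := fun ω ω' hω =>
    Walk.ext (List.map_injective_iff.2 R.injective (congrArg Walk.pts hω))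
  refine le_trans (ENNReal.tsum_le_tsum fun ω => ?_) (ENNReal.tsum_comp_le_tsum_of_injective hinj _)
  have hlen : (ω.map R hR).len = ω.len := by simp [Walk.len, Walk.map]
  have hwt : wt lam z (ω.map R hR) = wt lam z ω := by
    rw [wt, wt, hlen]
    exact congrArg _ (h.loopWt_map hR ω.chain)
  have hrange : (ω.map R hR).range = R '' ω.range := by
    ext x
    simp only [Walk.range, Walk.map, Set.mem_ofPred_eq, List.mem_map, Set.mem_image]
  have hloop : ω.IsLoop → (ω.map R hR).IsLoop := by
    rintro ⟨h1, h2⟩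
    refine ⟨hlen ▸ h1, ?_⟩
    obtain ⟨p, hp, hc⟩ := ω
    obtain ⟨v, p, rfl⟩ := List.exists_cons_of_ne_nil hp
    simp only [Walk.finish, Walk.start, Walk.map, List.map_cons, List.headI_cons] at h2 ⊢
    rw [← List.map_cons, List.getLastD_eq_getLast?, List.getLast?_map]
    rw [List.getLastD_eq_getLast?] at h2
    rw [List.getLast?_eq_getLast_of_ne_nil (by simp)] at h2 ⊢
    simpa using h2
  rw [hrange, hwt, hlen, ← Set.image_inter R.injective, ← Set.image_inter R.injective]
  by_cases hc : ω.IsLoop ∧ (ω.range ∩ A).Nonempty ∧ ω.range ∩ B = ∅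
  · rw [if_pos hc, if_pos]
    exact ⟨hloop hc.1, hc.2.1.image R, by rw [hc.2.2, Set.image_empty]⟩
  · rw [if_neg hc]
    exact zero_le

theorem Adj.exists_single {u : Pt d} (hu : Adj u 0) :
    ∃ i, (u i) ^ 2 = 1 ∧ ∀ k, k ≠ i → u k = 0 := by
  have h : ∑ i, (u i).natAbs = 1 := by simpa [Adj, dist1] using hu
  obtain ⟨i, -, hi⟩ := Finset.exists_ne_zero_of_sum_ne_zero (h.trans_ne one_ne_zero)
  rw [← Finset.add_sum_erase _ _ (Finset.mem_univ i)] at h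
  refine ⟨i, ?_, fun k hk => ?_⟩
  · have : (u i).natAbs = 1 := by omega
    rw [← Int.natAbs_sq, this]
    rfl
  · have h0 : ∑ j ∈ Finset.univ.erase i, (u j).natAbs = 0 := by omega
    exact Int.natAbs_eq_zero.1 (Finset.sum_eq_zero_iff.1 h0 k (by simp [hk]))

/-- The neighbours of the origin are equivalent under isometries fixing the origin. -/
theorem exists_iso {u e : Pt d} (hu : Adj u 0) (he : Adj e 0) :
    ∃ R : Pt d ≃ Pt d, IsLatticeIso R ∧ R 0 = 0 ∧ R u = e := by
  obtain ⟨i, hi, hi'⟩ := hu.exists_single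
  obtain ⟨j, hj, hj'⟩ := he.exists_single
  have hs : (u i * e j) * (u i * e j) = 1 := by
    linear_combination hi * (e j) ^ 2 + hj
  let f : Pt d → Pt d := fun x k => u i * e j * x (Equiv.swap i j k)
  have hf : Function.Involutive f := by
    intro x
    ext k
    simp only [f, Equiv.swap_apply_self, ← mul_assoc, hs, one_mul]
  refine ⟨hf.toPerm, fun x y => ?_, ?_, ?_⟩
  · have habs : (u i * e j).natAbs = 1 := Int.isUnit_iff_natAbs_eq.1 (IsUnit.of_mul_eq_one _ hs)
    simp only [dist1, Function.Involutive.coe_toPerm, f, ← mul_sub, Int.natAbs_mul, habs, one_mul]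
    exact Equiv.sum_comp (Equiv.swap i j) fun k => (x k - y k).natAbs
  · ext k
    simp [f]
  · ext k
    simp only [Function.Involutive.coe_toPerm, f]
    by_cases hk : k = j
    · subst hk
      rw [Equiv.swap_apply_right]
      linear_combination hi * e k
    · have hne : Equiv.swap i j k ≠ i := fun h =>
        hk ((Equiv.eq_symm_apply _).2 h |>.trans (by simp))
      rw [hj' k hk, hi' _ hne, mul_zero]

theorem mu_le_of_adj (h : SymmAssumption lam) (z : ℝ≥0) {u e : Pt d} (hu : Adj u 0)
    (he : Adj e 0) : mu lam z {0} {u} ≤ mu lam z {0} {e} := by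
  obtain ⟨R, hR, h0, h1⟩ := exists_iso hu he
  have := mu_le_of_iso h z hR {0} {u}
  rwa [Set.image_singleton, Set.image_singleton, h0, h1] at this

theorem tsum_walk (F : List (Pt d) → ℝ≥0∞) : ∑' ω : Walk d, F ω.pts =
    ∑' v, ∑' p, if (v :: p).IsChain Adj then F (v :: p) else 0 := by
  rw [← ENNReal.tsum_prod (f := fun v p => if (v :: p).IsChain Adj then F (v :: p) else 0)]
  have hg : ∀ ω : Walk d, ω.pts.headI :: ω.pts.tail = ω.pts := fun ω => by
    obtain ⟨v, p, h⟩ := List.exists_cons_of_ne_nil ω.ne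
    simp [h]
  have hinj : Function.Injective fun ω : Walk d => (ω.pts.headI, ω.pts.tail) := by
    intro ω ω' h
    refine Walk.ext ?_
    rw [← hg ω, ← hg ω']
    simp only [Prod.mk.injEq] at h
    rw [h.1, h.2]
  rw [← hinj.tsum_eq]
  · refine tsum_congr fun ω => ?_
    simp only [hg]
    exact (if_pos ω.chain).symm
  · rintro ⟨v, p⟩ h
    have hc : (v :: p).IsChain Adj := by
      by_contra hc
      simp [hc] at h
    exact ⟨⟨v :: p, by simp, hc⟩, rfl⟩

theorem G_eq (z : ℝ≥0) (x y : Pt d) : G lam z x y =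
    ∑' p : List (Pt d), (if (x :: p).getLast? = some y then walkWt Adj lam (x :: p) else 0) *
      (z : ℝ≥0∞) ^ p.length := by
  refine (tsum_walk fun l => if l.headI = x ∧ l.getLastD default = y then
    (z : ℝ≥0∞) ^ (l.length - 1) * loopWt lam l else 0).trans ?_
  rw [tsum_eq_single x]
  · refine tsum_congr fun p => ?_
    simp only [walkWt, List.headI_cons, true_and, List.getLastD_eq_getLast?, List.length_cons,
      Nat.add_sub_cancel, List.getLast?_cons, Option.getD_some, Option.some.injEq]
    split_ifs <;> simp [mul_comm]
  · intro v hv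
    simp [hv]

theorem sum_loops_le_mu (z : ℝ≥0) {D : Finset (Pt d)} {o u : Pt d} (hu : u ∉ D) :
    (∑ v ∈ D, ∑' p : List (Pt d), if ((∀ w ∈ p, w ∈ D) ∧ ClosedTail v p) ∧ o ∈ p then
      walkWt Adj lam (v :: p) * ((z : ℝ≥0∞) ^ p.length / p.length) else 0) ≤
      mu lam z {o} {u} := by
  have hmu : mu lam z {o} {u} = ∑' v, ∑' p, if (v :: p).IsChain Adj then
      (if (1 ≤ (v :: p).length - 1 ∧ (v :: p).getLastD default = (v :: p).headI) ∧
        ({x | x ∈ v :: p} ∩ {o}).Nonempty ∧ {x | x ∈ v :: p} ∩ {u} = ∅ then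
      (z : ℝ≥0∞) ^ ((v :: p).length - 1) * loopWt lam (v :: p) / ((v :: p).length - 1 : ℕ)
      else 0) else 0 := by
    rw [← tsum_walk fun l => if (1 ≤ l.length - 1 ∧ l.getLastD default = l.headI) ∧
      ({x | x ∈ l} ∩ {o}).Nonempty ∧ {x | x ∈ l} ∩ {u} = ∅ then
      (z : ℝ≥0∞) ^ (l.length - 1) * loopWt lam l / (l.length - 1 : ℕ) else 0]
    exact tsum_congr fun ω => if_congr Iff.rfl rfl rfl
  rw [hmu]
  refine le_trans (Finset.sum_le_sum fun v hv => ?_) (ENNReal.sum_le_tsum D)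
  refine ENNReal.tsum_le_tsum fun p => ?_
  split_ifs with h1 h2 h3
  · rw [walkWt, if_pos h2, List.length_cons, Nat.add_sub_cancel, ← mul_div_assoc, mul_comm]
  · refine absurd ?_ h3
    refine ⟨⟨?_, ?_⟩, ⟨o, by simp [h1.2]⟩, ?_⟩
    · have := List.length_pos_of_mem h1.2
      rw [List.length_cons]
      omega
    · obtain rfl | ⟨q, rfl⟩ := h1.1.2
      · rfl
      · rw [← List.cons_append, List.getLastD_concat]
        rfl
    · ext x
      simp only [Set.mem_inter_iff, Set.mem_ofPred_eq, Set.mem_singleton_iff, Set.mem_empty_iff_false,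
        iff_false, not_and]
      rintro hx rfl
      rcases List.mem_cons.1 hx with rfl | hx
      exacts [hu hv, hu (h1.1.1 x hx)]
  · rw [walkWt, if_neg h2, zero_mul]
  all_goals exact zero_le

theorem eexp_mono {a b : ℝ≥0∞} (h : a ≤ b) : eexp a ≤ eexp b := by
  rw [eexp, eexp]
  split_ifs with ha hb hb
  · exact le_rfl
  · exact absurd (top_le_iff.1 (ha ▸ h)) hb
  · exact le_top
  · exact ENNReal.ofReal_le_ofReal (Real.exp_le_exp.2 (ENNReal.toReal_mono hb h))

theorem Adj.symm {x y : Pt d} (h : Adj x y) : Adj y x := by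
  rw [Adj, dist1] at h ⊢
  rw [← h]
  exact Finset.sum_congr rfl fun i _ => by omega

theorem tsum_neighbour_walks (z : ℝ≥0) (o y : Pt d) :
    (∑' q : List (Pt d), (if (∃ u ∈ q.head?, Adj o u) ∧ q.getLast? = some y then
      walkWt Adj lam q else 0) * (z : ℝ≥0∞) ^ q.length) =
    z * ∑' u : Pt d, if Adj u o then G lam z u y else 0 := by
  have hinj : Function.Injective fun a : Pt d × List (Pt d) => a.1 :: a.2 := by
    rintro ⟨v, p⟩ ⟨v', p'⟩ h
    simpa using h
  rw [← hinj.tsum_eq]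
  · rw [ENNReal.tsum_prod (f := fun v p => (if (∃ u ∈ (v :: p).head?, Adj o u) ∧
      (v :: p).getLast? = some y then walkWt Adj lam (v :: p) else 0) *
      (z : ℝ≥0∞) ^ (v :: p).length), ← ENNReal.tsum_mul_left]
    refine tsum_congr fun v => ?_
    by_cases h : Adj v o
    · rw [if_pos h, G_eq, ← ENNReal.tsum_mul_left]
      refine tsum_congr fun p => ?_
      simp only [List.head?_cons, Option.mem_some_iff, exists_eq_left', h.symm, true_and,
        List.length_cons, pow_succ]
      ring
    · have h' : ¬ Adj o v := fun h' => h h'.symm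
      simp [h, h']
  · intro q hq
    cases q with
    | nil => simp at hq
    | cons v p => exact ⟨(v, p), rfl⟩

end Lattice
/-- **One-step bound for the λ-LWW two-point function.**  Let `λ` be nonnegative loop
activities satisfying the symmetry assumption, `z ≥ 0`, and let
`α(λ,z) = exp(μ_{λ,z}({0};{e}))` where `e` is any vertex adjacent to `0` (by the
symmetry assumption this value is independent of the choice of `e`).  Then for every
`y ≠ 0`, `G_{λ,z}(0,y) ≤ z·α(λ,z)·Σ_{‖u‖₁=1} G_{λ,z}(u,y)` in `[0,∞]`. -/
theorem one_step_bound {d : ℕ} (lam : List (Pt d) → ℝ≥0) (z : ℝ≥0)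
    (hsym : SymmAssumption lam) (e : Pt d) (he : Adj e 0) (y : Pt d) (hy : y ≠ 0) :
    G lam z 0 y
      ≤ (z : ℝ≥0∞) * eexp (mu lam z {0} {e})
          * ∑' u : Pt d, (if Adj u 0 then G lam z u y else 0) := by
  have h := hsym.rotInvariant
  rw [G_eq, mul_right_comm, ← tsum_neighbour_walks]
  refine h.tsum_path_le hy fun E u h0 hu h0u => ?_
  refine (h.ev_loopSeries_le h0 z).trans (eexp_mono ?_)
  exact (sum_loops_le_mu z hu).trans (mu_le_of_adj hsym z h0u.symm he)

end LWW
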